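/- arXiv:0806.4820 — 2 statements merged into one kernel-verified Lean document; each statement's English description precedes it below -/
import Mathlib

section
/- (Additivity of j-multiplicity.) Let (R, 𝔪) be a Noetherian local ring with dim R > 0 and R/𝔪 infinite, let I be a proper ideal, and let d be a positive integer. If 0 → L → M → N → 0 is an exact sequence of finitely generated R-modules with dim_R M ≤ d, then j_d(I, M) = j_d(I, L) + j_d(I, N). -/
open Filter

noncomputable section

/-- The length of a module, as the height of `⊤` in the submodule lattice. -/
def mLength (R M : Type*) [CommRing R] [AddCommGroup M] [Module R M] : ℕ∞ :=
  Order.height (⊤ : Submodule R M)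

/-- The Krull dimension of a module, via the annihilator. -/
def mDim (R M : Type*) [CommRing R] [AddCommGroup M] [Module R M] : WithBot ℕ∞ :=
  ringKrullDim (R ⧸ Module.annihilator R M)

/-- `H⁰_I(N)`: elements killed by a power of `I` (0-th local cohomology). -/
def H0 {R : Type*} [CommRing R] (I : Ideal R) (N : Type*) [AddCommGroup N] [Module R N] :
    Submodule R N :=
  ⨆ n : ℕ, Submodule.torsionBySet R N ((I ^ n : Ideal R) : Set R)

/-- `IⁿM/I^{n+1}M`, as a submodule of `M/I^{n+1}M`. -/
def gradedPiece {R : Type*} [CommRing R] (I : Ideal R) {M : Type*} [AddCommGroup M]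
    [Module R M] (n : ℕ) : Submodule R (M ⧸ (I ^ (n + 1) • ⊤ : Submodule R M)) :=
  Submodule.map (I ^ (n + 1) • ⊤ : Submodule R M).mkQ (I ^ n • ⊤ : Submodule R M)

/-- The `j`-multiplicity `j_d(I, M)`, defined as
`lim_n (d−1)!/n^(d−1) · length_R (H⁰_𝔪(IⁿM/I^{n+1}M))`. -/
def jMult {R : Type*} [CommRing R] (𝔪 I : Ideal R) (M : Type*) [AddCommGroup M]
    [Module R M] (d : ℕ) : ℝ :=
  limUnder atTop fun n : ℕ =>
    ((d - 1).factorial : ℝ) / (n : ℝ) ^ (d - 1) *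
      ((mLength R (H0 𝔪 (gradedPiece I (M := M) n))).toNat : ℝ)

/-- The Hilbert–Samuel multiplicity `e(I; N)` of a `d`-dimensional module `N`
(equal to `0` if `N = 0`), defined as `lim_n d!/n^d · length_R (N/IⁿN)`. -/
def hsMult {R : Type*} [CommRing R] (I : Ideal R) (N : Type*) [AddCommGroup N]
    [Module R N] (d : ℕ) : ℝ :=
  limUnder atTop fun n : ℕ =>
    (d.factorial : ℝ) / (n : ℝ) ^ d *
      ((mLength R (N ⧸ (I ^ n • ⊤ : Submodule R N))).toNat : ℝ)

/-- `K :_M I^∞ = ⋃ₙ (K :_M Iⁿ)`. -/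
def satur {R : Type*} [CommRing R] (I : Ideal R) {M : Type*} [AddCommGroup M] [Module R M]
    (K : Submodule R M) : Submodule R M :=
  Submodule.comap K.mkQ (H0 I (M ⧸ K))

/-- "For general elements `a₁, …, aᵢ` of `I`", i.e. for all `i`-tuples of elements of `I`
whose coefficient vectors with respect to any finite generating set of `I` avoid the zero
locus of some nonzero polynomial over the residue field `R/𝔪` (equivalently, whose images
lie in a suitable nonempty Zariski-open set of choices modulo `𝔪I`), property `P` holds. -/
def GeneralElts {R : Type*} [CommRing R] (𝔪 I : Ideal R) (i : ℕ)
    (P : (Fin i → R) → Prop) : Prop :=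
  ∀ (m : ℕ) (x : Fin m → R), Ideal.span (Set.range x) = I →
    ∃ F : MvPolynomial (Fin i × Fin m) R,
      MvPolynomial.map (Ideal.Quotient.mk 𝔪) F ≠ 0 ∧
      ∀ c : Fin i × Fin m → R,
        MvPolynomial.eval (fun p => Ideal.Quotient.mk 𝔪 (c p))
          (MvPolynomial.map (Ideal.Quotient.mk 𝔪) F) ≠ 0 →
        P fun j => ∑ l, c (j, l) * x l

/-- A sequence of natural numbers that eventually agrees with a rational polynomial. -/
def EventuallyPoly (f : ℕ → ℚ) : Prop :=
  ∃ p : Polynomial ℚ, ∀ᶠ n : ℕ in atTop, f n = p.eval (n : ℚ)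

namespace EventuallyPoly

lemma congr' {f g : ℕ → ℚ} (hf : EventuallyPoly f) (h : ∀ᶠ n in atTop, g n = f n) :
    EventuallyPoly g := by
  obtain ⟨p, hp⟩ := hf
  exact ⟨p, by filter_upwards [hp, h] with n h1 h2; rw [h2, h1]⟩

lemma sub {f g : ℕ → ℚ} (hf : EventuallyPoly f) (hg : EventuallyPoly g) :
    EventuallyPoly (fun n => f n - g n) := by
  obtain ⟨p, hp⟩ := hf
  obtain ⟨q, hq⟩ := hg
  exact ⟨p - q, by filter_upwards [hp, hq] with n h1 h2; simp [h1, h2]⟩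

lemma exists_forward_antidifference (p : Polynomial ℚ) :
    ∃ q : Polynomial ℚ, ∀ x : ℚ, q.eval (1 + x) = q.eval x + p.eval x := by
  induction p using Polynomial.induction_on' with
  | add p q hp hq =>
    obtain ⟨p', hp'⟩ := hp
    obtain ⟨q', hq'⟩ := hq
    exact ⟨p' + q', fun x => by simp only [Polynomial.eval_add, hp', hq']; ring⟩
  | monomial n a =>
    refine ⟨Polynomial.C (a / (n + 1)) * Polynomial.bernoulli (n + 1), fun x => ?_⟩
    have : (n : ℚ) + 1 ≠ 0 := by positivity
    simp only [Polynomial.eval_mul, Polynomial.eval_C, Polynomial.bernoulli_eval_one_add,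
      Polynomial.eval_monomial]
    push_cast
    field_simp

lemma of_forward_difference {f : ℕ → ℚ} (hf : EventuallyPoly (fun n => f (n + 1) - f n)) :
    EventuallyPoly f := by
  obtain ⟨p, hp⟩ := hf
  obtain ⟨q, hq⟩ := exists_forward_antidifference p
  obtain ⟨N, hN⟩ := eventually_atTop.1 hp
  refine ⟨q + Polynomial.C (f N - q.eval (N : ℚ)), eventually_atTop.2 ⟨N, fun n hn => ?_⟩⟩
  induction n, hn using Nat.le_induction with
  | base => simp
  | succ n hn ih =>
    have h1 := hN n hn
    have h2 := hq n
    simp only [Polynomial.eval_add, Polynomial.eval_C] at ih ⊢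
    push_cast
    rw [add_comm (n : ℚ) 1, h2]
    linarith

/-- A polynomial sequence whose partial sums are `O(r ^ e)` has degree less than `e`. -/
lemma exists_degree_lt {f : ℕ → ℕ} (hf : EventuallyPoly (fun n => (f n : ℚ))) {e C : ℕ}
    (hC : ∀ r ≥ 1, ∑ n ∈ Finset.range r, f n ≤ C * r ^ e) :
    ∃ p : Polynomial ℝ, p.degree < e ∧ ∀ᶠ n : ℕ in atTop, (f n : ℝ) = p.eval (n : ℝ) := by
  obtain ⟨p₀, hp₀⟩ := hf
  set p := p₀.map (algebraMap ℚ ℝ) with hpdef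
  have hp : ∀ᶠ n : ℕ in atTop, (f n : ℝ) = p.eval (n : ℝ) := by
    filter_upwards [hp₀] with n hn
    have : ((f n : ℚ) : ℝ) = ((p₀.eval (n : ℚ) : ℚ) : ℝ) := by rw [hn]
    rw [hpdef, Polynomial.eval_natCast_map]
    simpa using this
  refine ⟨p, ?_, hp⟩
  by_contra! hdeg
  have hp0 : p ≠ 0 := by
    rintro h
    rw [h, Polynomial.degree_zero] at hdeg
    simp at hdeg
  set D := p.natDegree
  have heD : e ≤ D := Polynomial.le_natDegree_of_coe_le_degree hdeg
  have hlim : Tendsto (fun n : ℕ => (f n : ℝ) / (n : ℝ) ^ D) atTop (nhds p.leadingCoeff) := by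
    have h1 := (Polynomial.div_tendsto_atTop_leadingCoeff_div_of_degree_eq p (Polynomial.X ^ D)
      (by simp [D, Polynomial.degree_eq_natDegree hp0])).comp tendsto_natCast_atTop_atTop
    simp only [Polynomial.leadingCoeff_X_pow, div_one] at h1
    refine h1.congr' ?_
    filter_upwards [hp] with n hn
    simp [hn]
  have hlc : 0 < p.leadingCoeff := by
    refine lt_of_le_of_ne (ge_of_tendsto' hlim fun n => by positivity) ?_
    exact (Polynomial.leadingCoeff_ne_zero.2 hp0).symm
  obtain ⟨N, hN⟩ := eventually_atTop.1 (hlim.eventually (lt_mem_nhds (half_lt_self hlc)))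
  obtain ⟨r, hr⟩ := exists_nat_gt (C * 2 ^ e / (p.leadingCoeff / 2))
  set s := max (max N 1) r
  have hs1 : 1 ≤ s := le_trans (le_max_right _ _) (le_max_left _ _)
  have hsN : N ≤ s := le_trans (le_max_left _ _) (le_max_left _ _)
  have hsr : r ≤ s := le_max_right _ _
  have h2 : (s : ℝ) * (p.leadingCoeff / 2 * (s : ℝ) ^ e) ≤ C * (2 * s : ℝ) ^ e := by
    have h3 := hC (s + s) (by lia)
    have h4 : ((∑ n ∈ Finset.range (s + s), f n : ℕ) : ℝ) ≤ C * ((s + s : ℕ) : ℝ) ^ e := by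
      exact_mod_cast h3
    rw [Finset.sum_range_add] at h4
    push_cast at h4
    have h5 : ∑ n ∈ Finset.range s, (p.leadingCoeff / 2 * (s : ℝ) ^ e) ≤
        ∑ n ∈ Finset.range s, (f (s + n) : ℝ) := by
      refine Finset.sum_le_sum fun n _ => ?_
      have h6 := hN (s + n) (by lia)
      have hpos : (0 : ℝ) < ((s + n : ℕ) : ℝ) := by
        have : 0 < s + n := by lia
        exact_mod_cast this
      rw [lt_div_iff₀ (by positivity)] at h6
      refine le_trans ?_ h6.le
      gcongr
      calc (s : ℝ) ^ e ≤ (s : ℝ) ^ D := pow_le_pow_right₀ (by exact_mod_cast hs1) heD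
        _ ≤ _ := by gcongr; lia
    have h7 : (0 : ℝ) ≤ ∑ n ∈ Finset.range s, (f n : ℝ) := by positivity
    simp only [Finset.sum_const, Finset.card_range, nsmul_eq_mul] at h5
    rw [two_mul]
    linarith
  have hspos : (0 : ℝ) < s := by exact_mod_cast hs1
  rw [div_lt_iff₀ (by positivity)] at hr
  have hsr' : (r : ℝ) ≤ s := by exact_mod_cast hsr
  have h8 : C * 2 ^ e < (s : ℝ) * (p.leadingCoeff / 2) := hr.trans_le (by gcongr)
  have h9 := mul_lt_mul_of_pos_right h8 (pow_pos hspos e)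
  rw [mul_pow] at h2
  linarith

lemma tendsto_div_pow_zero {f : ℕ → ℕ} (hf : EventuallyPoly (fun n => (f n : ℚ))) {e C : ℕ}
    (hC : ∀ r ≥ 1, ∑ n ∈ Finset.range r, f n ≤ C * r ^ e) :
    Tendsto (fun n : ℕ => (f n : ℝ) / (n : ℝ) ^ e) atTop (nhds 0) := by
  obtain ⟨p, hdeg, hp⟩ := hf.exists_degree_lt hC
  have h1 := (Polynomial.div_tendsto_atTop_zero_of_degree_lt p (Polynomial.X ^ e)
    (by simpa using hdeg)).comp tendsto_natCast_atTop_atTop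
  refine h1.congr' ?_
  filter_upwards [hp] with n hn
  simp [hn]

lemma exists_tendsto_div_pow {f : ℕ → ℕ} (hf : EventuallyPoly (fun n => (f n : ℚ))) {e C : ℕ}
    (hC : ∀ r ≥ 1, ∑ n ∈ Finset.range r, f n ≤ C * r ^ (e + 1)) :
    ∃ a : ℝ, Tendsto (fun n : ℕ => (f n : ℝ) / (n : ℝ) ^ e) atTop (nhds a) := by
  obtain ⟨p, hdeg, hp⟩ := hf.exists_degree_lt hC
  suffices h : ∃ a : ℝ, Tendsto (fun x : ℝ => p.eval x / (Polynomial.X ^ e : Polynomial ℝ).eval x)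
      atTop (nhds a) by
    obtain ⟨a, ha⟩ := h
    refine ⟨a, (ha.comp tendsto_natCast_atTop_atTop).congr' ?_⟩
    filter_upwards [hp] with n hn
    simp [hn]
  have hle : p.degree ≤ e := by
    rw [Polynomial.degree_lt_iff_coeff_zero] at hdeg
    rw [Polynomial.degree_le_iff_coeff_zero]
    exact fun m hm => hdeg m (by exact_mod_cast hm)
  rcases hle.lt_or_eq with h | h
  · exact ⟨0, Polynomial.div_tendsto_atTop_zero_of_degree_lt _ _ (by simpa using h)⟩
  · exact ⟨_, Polynomial.div_tendsto_atTop_leadingCoeff_div_of_degree_eq _ _ (by simpa using h)⟩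

end EventuallyPoly

section RelLen

variable {R M N : Type*} [CommRing R] [AddCommGroup M] [Module R M] [AddCommGroup N] [Module R N]

/-- The length of `(P + Q) / Q`, for submodules `P` and `Q`. -/
def relLen (P Q : Submodule R M) : ℕ∞ := Module.length R (P.map Q.mkQ)

lemma length_map_congr {Y Z : Type*} [AddCommGroup Y] [Module R Y] [AddCommGroup Z] [Module R Z]
    (P : Submodule R M) (φ : M →ₗ[R] Y) (ψ : M →ₗ[R] Z) (h : ∀ z ∈ P, φ z = 0 ↔ ψ z = 0) :
    Module.length R (P.map φ) = Module.length R (P.map ψ) := by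
  have hker : LinearMap.ker (φ.domRestrict P) = LinearMap.ker (ψ.domRestrict P) := by
    ext ⟨z, hz⟩
    simpa using h z hz
  rw [← LinearMap.range_domRestrict, ← LinearMap.range_domRestrict]
  exact ((φ.domRestrict P).quotKerEquivRange.symm.trans
    ((Submodule.quotEquivOfEq _ _ hker).trans (ψ.domRestrict P).quotKerEquivRange)).length_eq

lemma relLen_map (φ : M →ₗ[R] N) (P : Submodule R M) (Q : Submodule R N) :
    relLen (P.map φ) Q = relLen P (Q.comap φ) := by
  unfold relLen
  rw [← Submodule.map_comp]
  exact length_map_congr _ _ _ fun z _ => by simp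

lemma relLen_congr {P Q Q' : Submodule R M} (h : ∀ z ∈ P, z ∈ Q ↔ z ∈ Q') :
    relLen P Q = relLen P Q' :=
  length_map_congr _ _ _ fun z hz => by simpa using h z hz

lemma relLen_sup_left (P Q : Submodule R M) : relLen (P ⊔ Q) Q = relLen P Q := by
  have : Q.map Q.mkQ = ⊥ := by simp
  rw [relLen, relLen, Submodule.map_sup, this, sup_bot_eq]

lemma relLen_eq_zero {P Q : Submodule R M} (h : P ≤ Q) : relLen P Q = 0 := by
  have : P.map Q.mkQ = ⊥ := by
    rwa [eq_bot_iff, Submodule.map_le_iff_le_comap, Submodule.comap_bot, Submodule.ker_mkQ]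
  rw [relLen, this, Module.length_bot]

lemma relLen_mono_left {P P' : Submodule R M} (h : P ≤ P') (Q : Submodule R M) :
    relLen P Q ≤ relLen P' Q :=
  Module.length_le_of_injective (Submodule.inclusion (Submodule.map_mono h))
    (Submodule.inclusion_injective _)

lemma relLen_add {P P' Q : Submodule R M} (h : Q ≤ P') (h' : P' ≤ P) :
    relLen P Q = relLen P P' + relLen P' Q := by
  have hm : ∀ x ∈ P.map Q.mkQ, Submodule.factor h x ∈ P.map P'.mkQ := by
    rintro _ ⟨z, hz, rfl⟩
    exact ⟨z, hz, rfl⟩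
  rw [add_comm]
  refine Module.length_eq_add_of_exact (Submodule.inclusion (Submodule.map_mono h'))
    ((Submodule.factor h).restrict hm) (Submodule.inclusion_injective _) ?_ ?_
  · rintro ⟨_, z, hz, rfl⟩
    exact ⟨⟨_, z, hz, rfl⟩, rfl⟩
  · rintro ⟨_, z, hz, rfl⟩
    constructor
    · intro h0
      have h1 : P'.mkQ z = 0 := congrArg Subtype.val h0
      exact ⟨⟨_, z, by simpa using h1, rfl⟩, rfl⟩
    · rintro ⟨⟨_, y, hy, rfl⟩, h1⟩
      have h2 : Q.mkQ y = Q.mkQ z := congrArg Subtype.val h1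
      refine Subtype.ext ?_
      change P'.mkQ z = 0
      have h3 : y - z ∈ Q := (Submodule.Quotient.eq Q).1 h2
      have h4 : z ∈ P' := by simpa using sub_mem hy (h h3)
      simpa using h4

lemma relLen_inf_right (P Q : Submodule R M) : relLen P (Q ⊓ P) = relLen P Q :=
  relLen_congr fun z hz => by simp [hz]

lemma relLen_anti_right (P : Submodule R M) {Q Q' : Submodule R M} (h : Q ≤ Q') :
    relLen P Q' ≤ relLen P Q := by
  rw [← relLen_inf_right P Q, ← relLen_inf_right P Q',
    relLen_add (inf_le_inf_right P h) inf_le_right]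
  exact le_self_add

lemma relLen_le_add (P P' Q : Submodule R M) : relLen P Q ≤ relLen P P' + relLen P' Q := by
  calc relLen P Q ≤ relLen (P ⊔ P' ⊔ Q) Q := relLen_mono_left (le_sup_left.trans le_sup_left) _
    _ = relLen (P ⊔ P' ⊔ Q) (P' ⊔ Q) + relLen (P' ⊔ Q) Q :=
        relLen_add le_sup_right (by gcongr; exact le_sup_right)
    _ ≤ _ := by
        rw [sup_assoc, relLen_sup_left, relLen_sup_left]
        gcongr
        exact relLen_anti_right _ le_sup_left

variable [IsLocalRing R] [IsNoetherianRing R]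

open IsLocalRing in
lemma relLen_ne_top {P Q : Submodule R M} (hP : P.FG) {k : ℕ} (h : maximalIdeal R ^ k • P ≤ Q) :
    relLen P Q ≠ ⊤ := by
  have hfin : Module.Finite R (P.map Q.mkQ) := Module.Finite.iff_fg.2 (hP.map _)
  have htors : Module.IsTorsionBySet R (P.map Q.mkQ) (maximalIdeal R ^ (k + 1) : Ideal R) := by
    rintro ⟨_, z, hz, rfl⟩ ⟨a, ha⟩
    refine Subtype.ext ?_
    change a • Q.mkQ z = 0
    rw [← map_smul, ← LinearMap.mem_ker, Submodule.ker_mkQ]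
    exact h (Submodule.smul_mem_smul (Ideal.pow_le_pow_right (Nat.le_succ k) ha) hz)
  let := htors.module
  have hne : maximalIdeal R ^ (k + 1) ≠ ⊤ := fun h1 =>
    (maximalIdeal.isMaximal R).ne_top (top_le_iff.1 (h1 ▸ Ideal.pow_le_self (Nat.succ_ne_zero k)))
  have : Nontrivial (R ⧸ maximalIdeal R ^ (k + 1)) := Ideal.Quotient.nontrivial_iff.2 hne
  have : IsLocalRing (R ⧸ maximalIdeal R ^ (k + 1)) :=
    IsLocalRing.of_surjective' _ Ideal.Quotient.mk_surjective
  have : IsArtinianRing (R ⧸ maximalIdeal R ^ (k + 1)) := by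
    rw [isArtinianRing_iff_isNilpotent_maximalIdeal]
    refine ⟨k + 1, ?_⟩
    have hle : maximalIdeal (R ⧸ maximalIdeal R ^ (k + 1)) ≤
        (maximalIdeal R).map (Ideal.Quotient.mk (maximalIdeal R ^ (k + 1))) := by
      intro x hx
      obtain ⟨a, rfl⟩ := Ideal.Quotient.mk_surjective x
      refine Ideal.mem_map_of_mem _ ((mem_maximalIdeal a).2 fun ha => ?_)
      exact (mem_maximalIdeal _).1 hx (ha.map _)
    refine le_bot_iff.1 ((Ideal.pow_right_mono hle _).trans ?_)
    rw [← Ideal.map_pow, Ideal.map_quotient_self]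
  have : IsScalarTower R (R ⧸ maximalIdeal R ^ (k + 1)) (P.map Q.mkQ) := htors.isScalarTower
  have : Module.Finite (R ⧸ maximalIdeal R ^ (k + 1)) (P.map Q.mkQ) :=
    Module.Finite.of_restrictScalars_finite R _ _
  rw [relLen, Module.length_eq_of_surjective (S := R) (R := R ⧸ maximalIdeal R ^ (k + 1))
    Ideal.Quotient.mk_surjective]
  exact Module.length_ne_top

end RelLen

section Filtrations

variable {R M : Type*} [CommRing R] [AddCommGroup M] [Module R M]

/-- A decreasing sequence of submodules with `I • F n ≤ F (n + 1)`. -/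
structure IsFiltr (I : Ideal R) (F : ℕ → Submodule R M) : Prop where
  succ_le : ∀ n, F (n + 1) ≤ F n
  smul_le : ∀ n, I • F n ≤ F (n + 1)

/-- A filtration that is eventually generated in lower degree. -/
structure IsStableFiltr (I : Ideal R) (F : ℕ → Submodule R M) : Prop extends IsFiltr I F where
  exists_le_smul : ∃ n₀, ∀ n ≥ n₀, F (n + 1) ≤ I • F n

namespace IsFiltr

variable {I J : Ideal R} {F F' D : ℕ → Submodule R M}

lemma antitone (hF : IsFiltr I F) : Antitone F := antitone_nat_of_succ_le hF.succ_le

lemma mono_ideal (hF : IsFiltr I F) (h : J ≤ I) : IsFiltr J F :=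
  ⟨hF.succ_le, fun n => (Submodule.smul_mono_left h).trans (hF.smul_le n)⟩

lemma shift (hF : IsFiltr I F) (k : ℕ) : IsFiltr I (fun n => F (n + k)) :=
  ⟨fun n => by simpa only [Nat.add_right_comm] using hF.succ_le (n + k),
    fun n => by simpa only [Nat.add_right_comm] using hF.smul_le (n + k)⟩

lemma sup (hF : IsFiltr I F) (hF' : IsFiltr I F') : IsFiltr I (fun n => F n ⊔ F' n) :=
  ⟨fun n => sup_le_sup (hF.succ_le n) (hF'.succ_le n), fun n => by
    rw [Submodule.smul_sup]
    exact sup_le_sup (hF.smul_le n) (hF'.smul_le n)⟩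

lemma inf (hF : IsFiltr I F) (hF' : IsFiltr I F') : IsFiltr I (fun n => F n ⊓ F' n) :=
  ⟨fun n => inf_le_inf (hF.succ_le n) (hF'.succ_le n), fun n =>
    le_inf ((smul_mono_right _ inf_le_left).trans (hF.smul_le n))
      ((smul_mono_right _ inf_le_right).trans (hF'.smul_le n))⟩

lemma comap (hF : IsFiltr I F) (φ : M →ₗ[R] M) : IsFiltr I (fun n => (F n).comap φ) :=
  ⟨fun n => Submodule.comap_mono (hF.succ_le n), fun n => by
    rw [← Submodule.map_le_iff_le_comap, Submodule.map_smul'']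
    exact (smul_mono_right _ (Submodule.map_comap_le _ _)).trans (hF.smul_le n)⟩

lemma map (hF : IsFiltr I F) (φ : M →ₗ[R] M) : IsFiltr I (fun n => (F n).map φ) :=
  ⟨fun n => Submodule.map_mono (hF.succ_le n), fun n => by
    rw [← Submodule.map_smul'']
    exact Submodule.map_mono (hF.smul_le n)⟩

lemma ideal_smul (hF : IsFiltr I F) (J : Ideal R) : IsFiltr I (fun n => J • F n) :=
  ⟨fun n => smul_mono_right _ (hF.succ_le n), fun n => by
    rw [← mul_smul, mul_comm, mul_smul]
    exact smul_mono_right _ (hF.smul_le n)⟩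

lemma const (P : Submodule R M) : IsFiltr I (fun _ => P) :=
  ⟨fun _ => le_rfl, fun _ => Submodule.smul_le_right⟩

lemma pow_smul (P : Submodule R M) : IsFiltr I (fun n => I ^ n • P) :=
  ⟨fun n => Submodule.smul_mono_left (Ideal.pow_le_pow_right n.le_succ), fun n => by
    rw [← mul_smul, pow_succ']⟩

/-- The bundled version of a filtration. -/
def toFiltration (hF : IsFiltr I F) : I.Filtration M := ⟨F, hF.succ_le, hF.smul_le⟩

end IsFiltr

namespace IsStableFiltr

variable {I : Ideal R} {F F' D : ℕ → Submodule R M}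

lemma pow_smul (P : Submodule R M) : IsStableFiltr I (fun n => I ^ n • P) :=
  ⟨.pow_smul P, 0, fun n _ => by rw [← mul_smul, pow_succ']⟩

lemma stable (hF : IsStableFiltr I F) : hF.toIsFiltr.toFiltration.Stable := by
  obtain ⟨n₀, h⟩ := hF.exists_le_smul
  exact ⟨n₀, fun n hn => (hF.smul_le n).antisymm (h n hn)⟩

lemma exists_add_le_pow_smul (hF : IsStableFiltr I F) :
    ∃ c, ∀ n, F (n + c) ≤ I ^ n • F 0 := by
  obtain ⟨n₀, h⟩ := hF.exists_le_smul
  refine ⟨n₀, fun n => ?_⟩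
  induction n with
  | zero => simpa using hF.antitone (Nat.zero_le n₀)
  | succ n ih =>
    rw [Nat.add_right_comm, pow_succ', mul_smul]
    exact (h (n + n₀) (by lia)).trans (smul_mono_right _ ih)

variable [IsNoetherianRing R] [Module.Finite R M]

lemma of_le (hF : IsStableFiltr I F) (hD : IsFiltr I D) (h : ∀ n, D n ≤ F n) :
    IsStableFiltr I D := by
  have h1 : hD.toFiltration.Stable := hF.stable.of_le (F' := hD.toFiltration) h
  obtain ⟨n₀, h2⟩ := h1
  exact ⟨hD, n₀, fun n hn => (h2 n hn).ge⟩

end IsStableFiltr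

/-- `F / F'` is eventually generated in lower degree over the Rees algebra of `I`. -/
def RelStable (I : Ideal R) (F F' : ℕ → Submodule R M) : Prop :=
  ∃ n₀, ∀ n ≥ n₀, F (n + 1) ≤ F' (n + 1) ⊔ I • F n

lemma IsStableFiltr.relStable {I : Ideal R} {F : ℕ → Submodule R M} (hF : IsStableFiltr I F)
    (F' : ℕ → Submodule R M) : RelStable I F F' := by
  obtain ⟨n₀, h⟩ := hF.exists_le_smul
  exact ⟨n₀, fun n hn => (h n hn).trans le_sup_right⟩

variable [IsNoetherianRing R] [Module.Finite R M]

lemma RelStable.of_le {I : Ideal R} {F F' K : ℕ → Submodule R M} (h : RelStable I F F')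
    (hF' : IsFiltr I F') (hK : IsFiltr I K) (hF'K : ∀ n, F' n ≤ K n) (hKF : ∀ n, K n ≤ F n) :
    RelStable I K F' := by
  obtain ⟨n₀, hn₀⟩ := h
  have hpow : ∀ n, F (n + n₀) ≤ F' (n + n₀) ⊔ I ^ n • F n₀ := by
    intro n
    induction n with
    | zero => simp
    | succ n ih =>
      rw [Nat.add_right_comm]
      refine (hn₀ (n + n₀) (by lia)).trans (sup_le le_sup_left ?_)
      refine (smul_mono_right _ ih).trans ?_
      rw [Submodule.smul_sup, ← mul_smul, ← pow_succ']
      exact sup_le_sup_right (hF'.smul_le _) _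
  have hD : IsStableFiltr I (fun n => K (n + n₀) ⊓ I ^ n • F n₀) :=
    (IsStableFiltr.pow_smul (F n₀)).of_le ((hK.shift n₀).inf (.pow_smul _)) fun n => inf_le_right
  obtain ⟨n₁, hn₁⟩ := hD.exists_le_smul
  refine ⟨n₁ + n₀, fun n hn => ?_⟩
  obtain ⟨m, rfl⟩ : ∃ m, n = m + n₀ := ⟨n - n₀, by lia⟩
  intro z hz
  have hz1 := hpow (m + 1) (by simpa only [Nat.add_right_comm] using hKF _ hz)
  obtain ⟨u, hu, v, hv, rfl⟩ := Submodule.mem_sup.1 hz1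
  have hu' : u ∈ F' (m + n₀ + 1) := by simpa only [Nat.add_right_comm] using hu
  have hvK : v ∈ K (m + 1 + n₀) := by
    have := sub_mem hz (hF'K _ hu')
    rw [add_sub_cancel_left] at this
    simpa only [Nat.add_right_comm] using this
  refine Submodule.add_mem_sup hu' ?_
  exact (smul_mono_right _ inf_le_left :
    I • (K (m + n₀) ⊓ I ^ m • F n₀) ≤ I • K (m + n₀)) (hn₁ m (by lia) ⟨hvK, hv⟩)

/-- **Hilbert–Serre**: the length of the graded pieces of a finitely generated graded module
over a Rees algebra is eventually polynomial when all these lengths are finite. -/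
theorem eventuallyPoly_relLen_span (S : Finset R) : ∀ {F F' : ℕ → Submodule R M},
    IsFiltr (Ideal.span (S : Set R)) F → IsFiltr (Ideal.span (S : Set R)) F' →
    (∀ n, F' n ≤ F n) → RelStable (Ideal.span (S : Set R)) F F' →
    (∀ n, relLen (F n) (F' n) ≠ ⊤) →
    EventuallyPoly (fun n => ((relLen (F n) (F' n)).toNat : ℚ)) := by
  classical
  induction S using Finset.induction_on with
  | empty =>
    rintro F F' hF hF' hle ⟨n₀, hn₀⟩ hfin
    refine ⟨0, eventually_atTop.2 ⟨n₀ + 1, fun n hn => ?_⟩⟩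
    obtain ⟨m, rfl⟩ : ∃ m, n = m + 1 := ⟨n - 1, by lia⟩
    have := hn₀ m (by lia)
    simp only [Finset.coe_empty, Ideal.span_empty, Submodule.bot_smul, sup_bot_eq] at this
    simp [relLen_eq_zero this]
  | insert x S hx ih =>
    intro F F' hF hF' hle hst hfin
    have hJ : Ideal.span ((insert x S : Finset R) : Set R) =
        Ideal.span {x} ⊔ Ideal.span (S : Set R) := by
      rw [Finset.coe_insert, Ideal.span_insert]
    have hxsmul : ∀ P : Submodule R M,
        Ideal.span {x} • P = P.map (LinearMap.lsmul R M x) := by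
      intro P
      rw [Submodule.ideal_span_singleton_smul]
      rfl
    have hS : Ideal.span (S : Set R) ≤ Ideal.span ((insert x S : Finset R) : Set R) :=
      hJ ▸ le_sup_right
    set K : ℕ → Submodule R M :=
      fun n => F n ⊓ (F' (n + 1)).comap (LinearMap.lsmul R M x) with hKdef
    set E : ℕ → Submodule R M :=
      fun n => F' (n + 1) ⊔ (F n).map (LinearMap.lsmul R M x) with hEdef
    have hK := hF.inf ((hF'.shift 1).comap (LinearMap.lsmul R M x))
    have hE := (hF'.shift 1).sup (hF.map (LinearMap.lsmul R M x))
    have hxF' : ∀ n, (F' n).map (LinearMap.lsmul R M x) ≤ F' (n + 1) := fun n => by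
      rw [← hxsmul]
      exact (Submodule.smul_mono_left (hJ ▸ le_sup_left)).trans (hF'.smul_le n)
    have hxF : ∀ n, (F n).map (LinearMap.lsmul R M x) ≤ F (n + 1) := fun n => by
      rw [← hxsmul]
      exact (Submodule.smul_mono_left (hJ ▸ le_sup_left)).trans (hF.smul_le n)
    have hF'K : ∀ n, F' n ≤ K n := fun n =>
      le_inf (hle n) (Submodule.map_le_iff_le_comap.1 (hxF' n))
    have hEF : ∀ n, E n ≤ F (n + 1) := fun n => sup_le (hle _) (hxF n)
    have e1 : ∀ n, relLen (F n) (F' n) = relLen (F n) (K n) + relLen (K n) (F' n) :=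
      fun n => relLen_add (hF'K n) inf_le_left
    have e2 : ∀ n, relLen (F (n + 1)) (F' (n + 1)) =
        relLen (F (n + 1)) (E n) + relLen (F n) (K n) := by
      intro n
      have e3 : relLen (E n) (F' (n + 1)) =
          relLen ((F n).map (LinearMap.lsmul R M x)) (F' (n + 1)) := by
        rw [← relLen_sup_left ((F n).map (LinearMap.lsmul R M x)), sup_comm]
      rw [relLen_add (le_sup_left : F' (n + 1) ≤ E n) (hEF n), e3, relLen_map]
      congr 1
      exact relLen_congr fun z hz => by simp [hKdef, hz]
    have hKfin : ∀ n, relLen (K n) (F' n) ≠ ⊤ := fun n h => hfin n (by rw [e1, h, add_top])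
    have hKfin' : ∀ n, relLen (F n) (K n) ≠ ⊤ := fun n h => hfin n (by rw [e1, h, top_add])
    have hEfin : ∀ n, relLen (F (n + 1)) (E n) ≠ ⊤ :=
      fun n h => hfin (n + 1) (by rw [e2, h, top_add])
    have hKst : RelStable (Ideal.span (S : Set R)) K F' := by
      obtain ⟨n₀, hn₀⟩ := hst.of_le hF' hK hF'K fun n => inf_le_left
      refine ⟨n₀, fun n hn => (hn₀ n hn).trans (sup_le le_sup_left ?_)⟩
      rw [hJ, Submodule.sup_smul, hxsmul]
      exact sup_le_sup_right (Submodule.map_le_iff_le_comap.2 inf_le_right) _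
    have hEst : RelStable (Ideal.span (S : Set R)) (fun n => F (n + 1)) E := by
      obtain ⟨n₀, hn₀⟩ := hst
      refine ⟨n₀, fun n hn => (hn₀ (n + 1) (by lia)).trans ?_⟩
      rw [hJ, Submodule.sup_smul, hxsmul, ← sup_assoc]
    have p1 := ih (hK.mono_ideal hS) (hF'.mono_ideal hS) hF'K hKst hKfin
    have p2 := ih ((hF.shift 1).mono_ideal hS) (hE.mono_ideal hS) hEF hEst hEfin
    refine EventuallyPoly.of_forward_difference ((p2.sub p1).congr' (.of_forall fun n => ?_))
    rw [e1 n, e2 n, ENat.toNat_add (hEfin n) (hKfin' n), ENat.toNat_add (hKfin' n) (hKfin n)]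
    push_cast
    ring

theorem eventuallyPoly_relLen {I : Ideal R} {F F' : ℕ → Submodule R M}
    (hF : IsFiltr I F) (hF' : IsFiltr I F') (hle : ∀ n, F' n ≤ F n) (hst : RelStable I F F')
    (hfin : ∀ n, relLen (F n) (F' n) ≠ ⊤) :
    EventuallyPoly (fun n => ((relLen (F n) (F' n)).toNat : ℚ)) := by
  obtain ⟨S, rfl⟩ := IsNoetherian.noetherian I
  exact eventuallyPoly_relLen_span S hF hF' hle hst hfin

end Filtrations

section ArtinRees

variable {R M : Type*} [CommRing R] [AddCommGroup M] [Module R M] {I : Ideal R}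
  {F D : ℕ → Submodule R M}

lemma IsFiltr.map_smul_submodule_le (hD : IsFiltr I D) (J : Ideal R) :
    J.map (algebraMap R (reesAlgebra I)) • hD.toFiltration.submodule ≤
      (hD.ideal_smul J).toFiltration.submodule := by
  refine Submodule.smul_le.2 fun r hr f hf => ?_
  refine Submodule.span_induction (p := fun r _ =>
    r • f ∈ (hD.ideal_smul J).toFiltration.submodule) ?_ ?_ ?_ ?_ hr
  · rintro _ ⟨a, ha, rfl⟩
    rw [Ideal.Filtration.mem_submodule]
    intro i
    rw [algebraMap_smul]
    exact Submodule.smul_mem_smul ha ((Ideal.Filtration.mem_submodule _ _).1 hf i)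
  · simp
  · intro x y _ _ hx hy
    rw [add_smul]
    exact add_mem hx hy
  · intro a x _ hx
    rw [smul_assoc]
    exact Submodule.smul_mem _ _ hx

lemma IsFiltr.single_mem_submodule (hF : IsFiltr I F) {n : ℕ} {z : M} (hz : z ∈ F n) :
    PolynomialModule.single R n z ∈ hF.toFiltration.submodule := by
  rw [Ideal.Filtration.mem_submodule]
  intro i
  rw [PolynomialModule.coeff_single, Finsupp.single_apply]
  split_ifs with h
  · exact h ▸ hz
  · exact zero_mem _

lemma IsFiltr.single_mem_map_smul (hF : IsFiltr I F) (J : Ideal R) {n : ℕ} {z : M}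
    (hz : z ∈ J • F n) : PolynomialModule.single R n z ∈
      J.map (algebraMap R (reesAlgebra I)) • hF.toFiltration.submodule := by
  refine Submodule.smul_induction_on hz (fun r hr y hy => ?_) (fun x y hx hy => ?_)
  · rw [PolynomialModule.single_smul, ← algebraMap_smul (reesAlgebra I)]
    exact Submodule.smul_mem_smul (Ideal.mem_map_of_mem _ hr) (hF.single_mem_submodule hy)
  · rw [PolynomialModule.single_add]
    exact add_mem hx hy

lemma exists_inf_pow_smul_le_pow_smul {A P : Type*} [CommRing A] [IsNoetherianRing A]
    [AddCommGroup P] [Module A P] {F D : Submodule A P} (hF : F.FG) (h : D ≤ F) (J : Ideal A) :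
    ∃ k, ∀ b, D ⊓ J ^ (b + k) • F ≤ J ^ b • D := by
  have : Module.Finite A F := Module.Finite.iff_fg.2 hF
  obtain ⟨k, hk⟩ := Ideal.exists_pow_inf_eq_pow_smul J (D.comap F.subtype)
  refine ⟨k, fun b => ?_⟩
  have h1 := hk (b + k) (by lia)
  rw [Nat.add_sub_cancel] at h1
  have h2 := congrArg (Submodule.map F.subtype) h1
  rw [Submodule.map_inf _ F.injective_subtype, Submodule.map_smul'', Submodule.map_smul'',
    Submodule.map_top, Submodule.range_subtype, Submodule.map_comap_subtype, inf_eq_right.2 h] at h2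
  rw [inf_comm, h2]
  refine smul_mono_right _ ((Submodule.map_mono inf_le_right).trans ?_)
  rw [Submodule.map_comap_subtype]
  exact inf_le_right

variable [IsNoetherianRing R] [Module.Finite R M]

/-- A version of the Artin–Rees lemma which is uniform along a stable filtration. -/
theorem IsStableFiltr.exists_inf_pow_smul_le (hF : IsStableFiltr I F) (hD : IsFiltr I D)
    (hle : ∀ n, D n ≤ F n) (J : Ideal R) :
    ∃ k, ∀ n b, D n ⊓ J ^ (b + k) • F n ≤ J ^ b • D n := by
  have hfg : hF.toIsFiltr.toFiltration.submodule.FG :=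
    (Ideal.Filtration.submodule_fg_iff_stable _ fun n => IsNoetherian.noetherian _).2 hF.stable
  have hDF : hD.toFiltration.submodule ≤ hF.toIsFiltr.toFiltration.submodule :=
    fun f hf i => hle i (hf i)
  obtain ⟨k, hk⟩ := exists_inf_pow_smul_le_pow_smul hfg hDF
    (J.map (algebraMap R (reesAlgebra I)))
  refine ⟨k, fun n b z hz => ?_⟩
  have h1 := hk b ⟨hD.single_mem_submodule hz.1, by
    rw [← Ideal.map_pow]
    exact hF.toIsFiltr.single_mem_map_smul _ hz.2⟩
  rw [← Ideal.map_pow] at h1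
  have h2 := hD.map_smul_submodule_le _ h1 n
  rw [PolynomialModule.coeff_single, Finsupp.single_eq_same] at h2
  exact h2

end ArtinRees

section Saturation

variable {R M N : Type*} [CommRing R] [AddCommGroup M] [Module R M] [AddCommGroup N] [Module R N]

lemma mem_H0 {J : Ideal R} {z : M} : z ∈ H0 J M ↔ ∃ k, ∀ a ∈ J ^ k, a • z = 0 := by
  rw [H0, Submodule.mem_iSup_of_directed]
  · simp [Submodule.mem_torsionBySet_iff]
  · refine Monotone.directed_le fun i j hij => ?_
    exact Submodule.torsionBySet_le_torsionBySet_of_subset (Ideal.pow_le_pow_right hij)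

lemma mem_satur {J : Ideal R} {Q : Submodule R M} {z : M} :
    z ∈ satur J Q ↔ ∃ k, ∀ a ∈ J ^ k, a • z ∈ Q := by
  rw [satur, Submodule.mem_comap, mem_H0]
  simp_rw [← map_smul, ← LinearMap.mem_ker, Submodule.ker_mkQ]

lemma le_satur (J : Ideal R) (Q : Submodule R M) : Q ≤ satur J Q :=
  fun _ hz => mem_satur.2 ⟨0, fun a _ => Q.smul_mem a hz⟩

lemma satur_mono (J : Ideal R) {Q Q' : Submodule R M} (h : Q ≤ Q') : satur J Q ≤ satur J Q' := by
  intro z hz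
  obtain ⟨k, hk⟩ := mem_satur.1 hz
  exact mem_satur.2 ⟨k, fun a ha => h (hk a ha)⟩

lemma satur_comap (J : Ideal R) (φ : M →ₗ[R] N) (Q : Submodule R N) :
    satur J (Q.comap φ) = (satur J Q).comap φ := by
  ext z
  simp [mem_satur]

lemma satur_inf (J : Ideal R) (P Q : Submodule R M) :
    satur J (P ⊓ Q) = satur J P ⊓ satur J Q := by
  refine le_antisymm (le_inf (satur_mono J inf_le_left) (satur_mono J inf_le_right)) ?_
  rintro z ⟨h1, h2⟩
  obtain ⟨k, hk⟩ := mem_satur.1 h1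
  obtain ⟨l, hl⟩ := mem_satur.1 h2
  exact mem_satur.2 ⟨k + l, fun a ha => ⟨hk a (Ideal.pow_le_pow_right (by lia) ha),
    hl a (Ideal.pow_le_pow_right (by lia) ha)⟩⟩

lemma smul_satur_le (I J : Ideal R) (Q : Submodule R M) : I • satur J Q ≤ satur J (I • Q) := by
  refine Submodule.smul_le.2 fun r hr z hz => ?_
  obtain ⟨k, hk⟩ := mem_satur.1 hz
  refine mem_satur.2 ⟨k, fun a ha => ?_⟩
  rw [smul_comm]
  exact Submodule.smul_mem_smul hr (hk a ha)

lemma exists_pow_smul_satur_le [IsNoetherian R M] (J : Ideal R) (Q : Submodule R M) :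
    ∃ k, J ^ k • satur J Q ≤ Q := by
  let f : ℕ →o Submodule R M := ⟨fun k => (Submodule.torsionBySet R (M ⧸ Q)
    ((J ^ k : Ideal R) : Set R)).comap Q.mkQ, fun i j hij => Submodule.comap_mono
      (Submodule.torsionBySet_le_torsionBySet_of_subset (Ideal.pow_le_pow_right hij))⟩
  have hf : ∀ k z, z ∈ f k ↔ ∀ a ∈ J ^ k, a • z ∈ Q := by
    intro k z
    change Q.mkQ z ∈ Submodule.torsionBySet R (M ⧸ Q) ((J ^ k : Ideal R) : Set R) ↔ _
    simp_rw [Submodule.mem_torsionBySet_iff, ← map_smul, ← LinearMap.mem_ker, Submodule.ker_mkQ]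
    simp
  obtain ⟨n, hn⟩ := monotone_stabilizes_iff_noetherian.2 inferInstance f
  refine ⟨n, Submodule.smul_le.2 fun a ha z hz => ?_⟩
  obtain ⟨k, hk⟩ := mem_satur.1 hz
  have h1 : z ∈ f (max n k) := f.monotone (le_max_right n k) ((hf k z).2 hk)
  rw [← hn _ (le_max_left n k)] at h1
  exact (hf n z).1 h1 a ha

lemma mem_satur_of_smul_mem_satur [IsNoetherian R M] {J : Ideal R} {Q : Submodule R M} {z : M}
    (h : ∀ a ∈ J, a • z ∈ satur J Q) : z ∈ satur J Q := by
  obtain ⟨k, hk⟩ := exists_pow_smul_satur_le J Q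
  refine mem_satur.2 ⟨k + 1, fun a ha => ?_⟩
  rw [pow_succ] at ha
  refine Submodule.mul_induction_on ha (fun x hx y hy => ?_) (fun x y hx hy => ?_)
  · rw [mul_smul]
    exact hk (Submodule.smul_mem_smul hx (h y hy))
  · rw [add_smul]
    exact add_mem hx hy

/-- The length of `H⁰_J((P + Q) / Q)`. -/
def satLen (J : Ideal R) (P Q : Submodule R M) : ℕ∞ := relLen (P ⊓ satur J Q) Q

lemma satLen_map (J : Ideal R) (φ : M →ₗ[R] N) (P : Submodule R M) (Q : Submodule R N) :
    satLen J (P.map φ) Q = satLen J P (Q.comap φ) := by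
  rw [satLen, satLen, satur_comap, ← relLen_map]
  congr 1
  ext w
  constructor
  · rintro ⟨⟨z, hz, rfl⟩, h⟩
    exact ⟨z, ⟨hz, h⟩, rfl⟩
  · rintro ⟨z, ⟨hz, h⟩, rfl⟩
    exact ⟨⟨z, hz, rfl⟩, h⟩

lemma satLen_inf_right (J : Ideal R) (P Q : Submodule R M) : satLen J P (Q ⊓ P) = satLen J P Q := by
  rw [satLen, satLen, satur_inf, inf_comm (satur J Q), ← inf_assoc, inf_eq_left.2 (le_satur J P)]
  exact relLen_congr fun z hz => and_iff_left hz.1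

lemma mLength_H0 (J : Ideal R) (P Q : Submodule R M) :
    mLength R (H0 J (P.map Q.mkQ)) = satLen J P Q := by
  have h1 : (H0 J (P.map Q.mkQ)).map (P.map Q.mkQ).subtype = (P ⊓ satur J Q).map Q.mkQ := by
    ext w
    constructor
    · rintro ⟨⟨_, z, hz, rfl⟩, h, rfl⟩
      obtain ⟨k, hk⟩ := mem_H0.1 h
      refine ⟨z, ⟨hz, mem_satur.2 ⟨k, fun a ha => ?_⟩⟩, rfl⟩
      have h2 : a • Q.mkQ z = 0 := congrArg Subtype.val (hk a ha)
      rwa [← map_smul, ← LinearMap.mem_ker, Submodule.ker_mkQ] at h2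
    · rintro ⟨z, ⟨hz, h⟩, rfl⟩
      obtain ⟨k, hk⟩ := mem_satur.1 h
      refine ⟨⟨Q.mkQ z, z, hz, rfl⟩, mem_H0.2 ⟨k, fun a ha => Subtype.ext ?_⟩, rfl⟩
      change a • Q.mkQ z = 0
      rw [← map_smul, ← LinearMap.mem_ker, Submodule.ker_mkQ]
      exact hk a ha
  rw [satLen, relLen, ← h1, mLength]
  have e := Submodule.equivMapOfInjective (P.map Q.mkQ).subtype (Submodule.injective_subtype _)
    (H0 J (P.map Q.mkQ))
  exact (Module.length_eq_height R _).symm.trans (LinearEquiv.length_eq (M := H0 J (P.map Q.mkQ))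
    (N := (H0 J (P.map Q.mkQ)).map (P.map Q.mkQ).subtype) e)

end Saturation

lemma exists_regular_of_fg {R A P : Type*} [CommRing R] [CommRing A] [Algebra R A]
    [IsNoetherianRing A] [AddCommGroup P] [Module A P] {F T : Submodule A P} (hF : F.FG)
    (J : Ideal R) (h : ∀ f ∈ F, (∀ a ∈ J, algebraMap R A a • f ∈ T) → f ∈ T) :
    ∃ x ∈ J, ∀ f ∈ F, algebraMap R A x • f ∈ T → f ∈ T := by
  have hXf : Module.Finite A (F.map T.mkQ) := Module.Finite.iff_fg.2 (hF.map _)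
  have hfin := associatedPrimes.finite A (F.map T.mkQ)
  have havoid : ¬ (J : Set R) ⊆ ⋃ p ∈ (hfin.toFinset : Set (Ideal A)),
      (p.comap (algebraMap R A) : Set R) := by
    rw [Ideal.subset_union_prime (⊤ : Ideal A) ⊤]
    · rintro ⟨p, hp, hJ⟩
      rw [Set.Finite.mem_toFinset, AssociatedPrimes.mem_iff, isAssociatedPrime_iff] at hp
      obtain ⟨hp, ⟨_, f, hf, rfl⟩, rfl⟩ := hp
      refine hp.ne_top ?_
      have : f ∈ T := h f hf fun a ha => by
        have h1 : algebraMap R A a • T.mkQ f = 0 := congrArg Subtype.val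
          ((Submodule.mem_bot A).1 (Submodule.mem_colon_singleton.1 (hJ ha)))
        rwa [← map_smul, ← LinearMap.mem_ker, Submodule.ker_mkQ] at h1
      rw [Ideal.eq_top_iff_one, Submodule.mem_colon_singleton, Submodule.mem_bot, one_smul]
      exact Subtype.ext (by simpa using this)
    · intro p hp _ _
      have := ((Set.Finite.mem_toFinset _).1 hp).isPrime
      exact Ideal.comap_isPrime _ _
  obtain ⟨x, hx, hxp⟩ := Set.not_subset.1 havoid
  refine ⟨x, hx, fun f hf hxf => ?_⟩
  by_contra hfT
  refine hxp ?_
  have : algebraMap R A x ∈ ⋃ p ∈ associatedPrimes A (F.map T.mkQ), (p : Set A) := by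
    rw [biUnion_associatedPrimes_eq_zero_divisors]
    refine ⟨⟨T.mkQ f, f, hf, rfl⟩, fun h0 => hfT ?_, Subtype.ext ?_⟩
    · simpa using congrArg Subtype.val h0
    · change algebraMap R A x • T.mkQ f = 0
      rwa [← map_smul, ← LinearMap.mem_ker, Submodule.ker_mkQ]
  simpa using this

section SatFiltr

variable {R M : Type*} [CommRing R] [AddCommGroup M] [Module R M] {I : Ideal R}
  {F F' : ℕ → Submodule R M}

lemma IsFiltr.satur (hF' : IsFiltr I F') (J : Ideal R) : IsFiltr I (fun n => satur J (F' n)) :=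
  ⟨fun n => satur_mono J (hF'.succ_le n),
    fun n => (smul_satur_le I J _).trans (satur_mono J (hF'.smul_le n))⟩

variable [IsNoetherianRing R] [Module.Finite R M]

lemma IsStableFiltr.inf_satur (hF : IsStableFiltr I F) (hF' : IsFiltr I F') (J : Ideal R) :
    IsStableFiltr I (fun n => F n ⊓ _root_.satur J (F' n)) :=
  hF.of_le (hF.toIsFiltr.inf (hF'.satur J)) fun _ => inf_le_left

lemma IsStableFiltr.exists_pow_smul_inf_satur_le (hF : IsStableFiltr I F) (hF' : IsFiltr I F')
    (J : Ideal R) : ∃ e, ∀ n, J ^ e • (F n ⊓ satur J (F' n)) ≤ F' n := by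
  obtain ⟨n₀, h₀⟩ := (hF.inf_satur hF' J).exists_le_smul
  choose e he using fun n => exists_pow_smul_satur_le J (F' n)
  have key : ∀ E n, (∀ i ≤ n₀, e i ≤ E) → J ^ E • (F n ⊓ satur J (F' n)) ≤ F' n := by
    intro E n hE
    induction n with
    | zero =>
      exact (Submodule.smul_mono (Ideal.pow_le_pow_right (hE 0 n₀.zero_le)) inf_le_right).trans
        (he 0)
    | succ n ih =>
      by_cases hn : n + 1 ≤ n₀
      · exact (Submodule.smul_mono (Ideal.pow_le_pow_right (hE _ hn)) inf_le_right).trans (he _)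
      · refine (smul_mono_right _ (h₀ n (by lia))).trans ?_
        rw [← mul_smul, mul_comm, mul_smul]
        exact (smul_mono_right _ ih).trans (hF'.smul_le n)
  exact ⟨(Finset.range (n₀ + 1)).sup e, fun n => key _ n fun i hi =>
    Finset.le_sup (Finset.mem_range.2 (by lia))⟩

/-- There is an element of `J` that is regular on the graded module `F / (F ∩ satur J F')`. -/
lemma IsStableFiltr.exists_regular (hF : IsStableFiltr I F) (hF' : IsFiltr I F') (J : Ideal R) :
    ∃ x ∈ J, ∀ n, ∀ z ∈ F n, x • z ∈ satur J (F' n) → z ∈ satur J (F' n) := by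
  have hT := (hF.inf_satur hF' J).toIsFiltr
  have hfg : hF.toIsFiltr.toFiltration.submodule.FG :=
    (Ideal.Filtration.submodule_fg_iff_stable _ fun n => IsNoetherian.noetherian _).2 hF.stable
  obtain ⟨x, hx, h⟩ := exists_regular_of_fg (T := hT.toFiltration.submodule) hfg J
    (fun f hf h i => ⟨hf i, mem_satur_of_smul_mem_satur fun a ha => by
      have h1 := (h a ha i).2
      rwa [algebraMap_smul] at h1⟩)
  refine ⟨x, hx, fun n z hz hxz => ?_⟩
  have h1 := h _ (hF.toIsFiltr.single_mem_submodule hz) (by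
    rw [algebraMap_smul, ← PolynomialModule.single_smul]
    exact hT.single_mem_submodule ⟨(F n).smul_mem x hz, hxz⟩) n
  rw [PolynomialModule.coeff_single, Finsupp.single_eq_same] at h1
  exact h1.2

end SatFiltr

section Growth

variable {R M : Type*} [CommRing R] [AddCommGroup M] [Module R M] {I : Ideal R}
  {F F' : ℕ → Submodule R M}

lemma relLen_sup_left_le (P : Submodule R M) {X Q : Submodule R M} (h : X ≤ Q) :
    relLen (P ⊔ X) Q ≤ relLen P Q :=
  (relLen_mono_left (sup_le_sup_left h P) Q).trans (relLen_sup_left P Q).le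

lemma relLen_sup_smul_le_sum (hF : Antitone F) (J : Ideal R) (n s : ℕ) :
    relLen (F n) (F (n + s) ⊔ J • F n) ≤
      ∑ i ∈ Finset.range s, relLen (F (n + i)) (F (n + i + 1) ⊔ J • F (n + i)) := by
  induction s with
  | zero => simp [relLen_eq_zero]
  | succ s ih =>
    rw [Finset.sum_range_succ]
    refine (relLen_le_add _ (F (n + s) ⊔ J • F n) _).trans (add_le_add ih ?_)
    refine (relLen_sup_left_le _ le_sup_right).trans (relLen_anti_right _ ?_)
    exact sup_le_sup_left (smul_mono_right _ (hF (by lia))) _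

lemma sum_range_sum_range_add_le (a : ℕ → ℕ∞) (r s : ℕ) :
    ∑ n ∈ Finset.range r, ∑ i ∈ Finset.range s, a (n + i) ≤
      s * ∑ n ∈ Finset.range (r + s), a n := by
  rw [Finset.sum_comm]
  calc _ ≤ ∑ i ∈ Finset.range s, ∑ n ∈ Finset.range (r + s), a n := by
        refine Finset.sum_le_sum fun i hi => ?_
        calc _ = ∑ n ∈ (Finset.range r).map (addRightEmbedding i), a n := by simp
          _ ≤ _ := by
            refine Finset.sum_le_sum_of_subset fun n hn => ?_
            simp only [Finset.mem_map, Finset.mem_range, addRightEmbedding_apply] at hn hi ⊢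
            obtain ⟨m, hm, rfl⟩ := hn
            lia
    _ = _ := by simp

variable [IsNoetherianRing R] [Module.Finite R M]

lemma IsStableFiltr.exists_pow_smul_zero_inf_le (hF : IsStableFiltr I F) (J : Ideal R) :
    ∃ k, ∀ n N, F n ⊓ J ^ (N + k * n) • F 0 ≤ J ^ N • F n := by
  obtain ⟨k, hk⟩ := hF.exists_inf_pow_smul_le (hF.toIsFiltr.shift 1) hF.succ_le J
  refine ⟨k, fun n => ?_⟩
  induction n with
  | zero => intro N; simp
  | succ n ih =>
    rintro N z ⟨h1, h2⟩
    refine hk n N ⟨h1, ih (N + k) ⟨hF.succ_le n h1, ?_⟩⟩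
    rwa [show N + k + k * n = N + k * (n + 1) by ring]

omit [IsNoetherianRing R] [Module.Finite R M] in
lemma sum_relLen_le_of_inf_le (hF : Antitone F) (J : Ideal R) (Q : Submodule R M) (r : ℕ)
    (h : ∀ n < r, F n ⊓ Q ≤ J • F n) :
    ∑ n ∈ Finset.range r, relLen (F n) (F (n + 1) ⊔ J • F n) ≤ relLen (F 0) Q := by
  suffices H : ∀ j ≤ r, ∑ n ∈ Finset.range j, relLen (F n) (F (n + 1) ⊔ J • F n) +
      relLen (F j) Q ≤ relLen (F 0) Q from le_self_add.trans (H r le_rfl)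
  intro j hj
  induction j with
  | zero => simp
  | succ j ih =>
    refine le_trans ?_ (ih (by lia))
    rw [Finset.sum_range_succ, add_assoc]
    gcongr
    rw [← relLen_inf_right (F j) Q, relLen_add (le_sup_right : Q ⊓ F j ≤ F (j + 1) ⊔ (Q ⊓ F j))
      (sup_le (hF j.le_succ) inf_le_right), relLen_sup_left]
    refine add_le_add (relLen_anti_right _ (sup_le_sup_left ?_ _)) (relLen_anti_right _ inf_le_left)
    rw [inf_comm]
    exact h j (by lia)

open IsLocalRing

variable [IsLocalRing R]

variable (R M) in
/-- The Hilbert–Samuel function of `M` is bounded by a monomial of degree `d`. -/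
def HasGrowth (d : ℕ) : Prop :=
  ∃ C : ℕ, ∀ N : ℕ, 1 ≤ N → relLen (⊤ : Submodule R M) (maximalIdeal R ^ N • ⊤) ≤ C * (N : ℕ∞) ^ d

lemma HasGrowth.exists_sum_le {d : ℕ} (hM : HasGrowth R M d) (hF : IsStableFiltr I F) {s : ℕ}
    (hs : ∀ n, F (n + s) ≤ F' n) (c : ℕ) :
    ∃ C : ℕ, ∀ r : ℕ, 1 ≤ r → ∑ n ∈ Finset.range r,
      relLen (F n) (F' n ⊔ maximalIdeal R ^ (c * r) • F n) ≤ C * (r : ℕ∞) ^ d := by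
  obtain ⟨C, hC⟩ := hM
  obtain ⟨k, hk⟩ := hF.exists_pow_smul_zero_inf_le (maximalIdeal R)
  obtain ⟨l, hl⟩ := exists_inf_pow_smul_le_pow_smul (IsNoetherian.noetherian (⊤ : Submodule R M))
    (le_top : F 0 ≤ ⊤) (maximalIdeal R)
  set K := c + k + k * s + l + 1
  refine ⟨s * (C * K ^ d), fun r hr => ?_⟩
  have h1 : relLen (F 0) (maximalIdeal R ^ (c * r + k * (r + s)) • F 0) ≤
      C * ((K * r : ℕ) : ℕ∞) ^ d := by
    refine le_trans ?_ (hC (K * r) (Nat.mul_pos (by lia) hr))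
    refine (relLen_anti_right _ (hl _)).trans ?_
    rw [inf_comm, relLen_inf_right]
    refine (relLen_mono_left le_top _).trans (relLen_anti_right _ (Submodule.smul_mono_left
      (Ideal.pow_le_pow_right ?_)))
    have : k * s + l ≤ (k * s + l) * r := Nat.le_mul_of_pos_right _ hr
    calc _ = (c + k) * r + (k * s + l) := by ring
      _ ≤ (c + k) * r + (k * s + l) * r + r := by lia
      _ = K * r := by simp only [K]; ring
  calc _ ≤ ∑ n ∈ Finset.range r, ∑ i ∈ Finset.range s, 
        relLen (F (n + i)) (F (n + i + 1) ⊔ maximalIdeal R ^ (c * r) • F (n + i)) := by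
        refine Finset.sum_le_sum fun n _ => ?_
        refine (relLen_anti_right _ (sup_le_sup_right (hs n) _)).trans ?_
        exact relLen_sup_smul_le_sum hF.antitone _ n s
    _ ≤ s * _ := sum_range_sum_range_add_le (fun n => relLen (F n)
        (F (n + 1) ⊔ maximalIdeal R ^ (c * r) • F n)) r s
    _ ≤ s * (C * ((K * r : ℕ) : ℕ∞) ^ d) := by
        gcongr
        refine (sum_relLen_le_of_inf_le hF.antitone _ _ _ fun n hn => ?_).trans h1
        refine le_trans (inf_le_inf_left _ (Submodule.smul_mono_left (Ideal.pow_le_pow_right ?_)))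
          (hk n (c * r))
        gcongr
    _ = _ := by push_cast; ring

end Growth

section Limits

open IsLocalRing Topology

variable {R M : Type*} [CommRing R] [AddCommGroup M] [Module R M] {I : Ideal R}
  {F F' F'' : ℕ → Submodule R M}

/-- A stable `I`-filtration `F` together with an `I`-filtration `F'` inside it such that
`F / F'` is a finitely generated module over the associated graded ring of a power of `I`. -/
structure IsAdmissible (I : Ideal R) (F F' : ℕ → Submodule R M) : Prop where
  stable : IsStableFiltr I F
  filtr : IsFiltr I F'
  le : ∀ n, F' n ≤ F n
  exists_add_le : ∃ s, ∀ n, F (n + s) ≤ F' n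

variable [IsNoetherianRing R] [Module.Finite R M]

lemma IsAdmissible.of_le_of_le (h : IsAdmissible I F F') (hF'' : IsFiltr I F'')
    (h1 : ∀ n, F' n ≤ F'' n) (h2 : ∀ n, F'' n ≤ F n) :
    IsAdmissible I F F'' ∧ IsAdmissible I F'' F' := by
  obtain ⟨s, hs⟩ := h.exists_add_le
  exact ⟨⟨h.stable, hF'', h2, s, fun n => (hs n).trans (h1 n)⟩,
    ⟨h.stable.of_le hF'' h2, h.filtr, h1, s, fun n => (h2 _).trans (hs n)⟩⟩

/-- The length function of `F / F'` divided by `n ^ e`. -/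
def lenRatio (e : ℕ) (F F' : ℕ → Submodule R M) (n : ℕ) : ℝ :=
  ((relLen (F n) (F' n)).toNat : ℝ) / (n : ℝ) ^ e

/-- The length function of `H⁰_J(F / F')` divided by `n ^ e`. -/
def satRatio (J : Ideal R) (e : ℕ) (F F' : ℕ → Submodule R M) (n : ℕ) : ℝ :=
  ((satLen J (F n) (F' n)).toNat : ℝ) / (n : ℝ) ^ e

lemma exists_relLen_add_le (hF : IsStableFiltr I F) (hF' : IsFiltr I F') (J : Ideal R) (k : ℕ) :
    ∃ c, ∀ n a,
      relLen (F n) (F n ⊓ satur J (F' n) ⊔ J ^ k • F n) +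
        relLen (F n) (F n ⊓ satur J (F' n) ⊔ J ^ a • F n) ≤
      relLen (F n) (F n ⊓ satur J (F' n) ⊔ J ^ (a + c) • F n) := by
  obtain ⟨x, hx, hreg⟩ := hF.exists_regular hF' J
  have hT := (hF.inf_satur hF' J).toIsFiltr
  set T := fun n => F n ⊓ satur J (F' n) with hTdef
  have hregk : ∀ n z, z ∈ F n → x ^ k • z ∈ T n → z ∈ T n := by
    rintro n z hz ⟨-, h⟩
    refine ⟨hz, ?_⟩
    induction k with
    | zero => simpa using h
    | succ k ih =>
      rw [pow_succ', mul_smul] at h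
      exact ih (hreg n _ ((F n).smul_mem _ hz) h)
  have hyF : ∀ n, (F n).map (LinearMap.lsmul R M (x ^ k)) ≤ J ^ k • F n := by
    rintro n _ ⟨z, hz, rfl⟩
    exact Submodule.smul_mem_smul (Ideal.pow_mem_pow hx k) hz
  obtain ⟨c, hc⟩ := hF.exists_inf_pow_smul_le
    (hT.sup (hF.toIsFiltr.map (LinearMap.lsmul R M (x ^ k))))
    (fun n => sup_le inf_le_left ((hyF n).trans Submodule.smul_le_right)) J
  refine ⟨c + k, fun n a => ?_⟩
  set Q := T n ⊔ J ^ (a + (c + k)) • F n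
  have hQF : Q ≤ F n := sup_le inf_le_left Submodule.smul_le_right
  have key : ∀ z ∈ F n, x ^ k • z ∈ Q → z ∈ T n ⊔ J ^ a • F n := by
    intro z hz hzQ
    obtain ⟨t, ht, u, hu, htu⟩ := Submodule.mem_sup.1 hzQ
    have hu1 : u ∈ J ^ a • (T n ⊔ (F n).map (LinearMap.lsmul R M (x ^ k))) := by
      refine hc n a ⟨?_, Submodule.smul_mono_left (Ideal.pow_le_pow_right (by lia)) hu⟩
      rw [eq_sub_of_add_eq' htu]
      exact sub_mem (Submodule.mem_sup_right ⟨z, hz, rfl⟩) (Submodule.mem_sup_left ht)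
    rw [Submodule.smul_sup, ← Submodule.map_smul''] at hu1
    obtain ⟨t', ht', _, ⟨w, hw, rfl⟩, htw⟩ := Submodule.mem_sup.1 hu1
    have hwF : w ∈ F n := Submodule.smul_le_right hw
    have h1 : z - w ∈ T n := by
      refine hregk n _ (sub_mem hz hwF) ?_
      have : x ^ k • (z - w) = t + t' := by
        rw [smul_sub, ← htu, ← htw, LinearMap.lsmul_apply]
        abel
      rw [this]
      exact add_mem ht (Submodule.smul_le_right ht')
    rw [← sub_add_cancel z w]
    exact Submodule.add_mem_sup h1 hw
  rw [relLen_add (le_sup_right : Q ≤ (F n).map (LinearMap.lsmul R M (x ^ k)) ⊔ Q)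
    (sup_le ((hyF n).trans Submodule.smul_le_right) hQF), relLen_sup_left, relLen_map]
  refine add_le_add (relLen_anti_right _ (sup_le ((hyF n).trans le_sup_right)
    (sup_le_sup_left (Submodule.smul_mono_left (Ideal.pow_le_pow_right (by lia))) _))) ?_
  rw [← relLen_inf_right (F n) (Q.comap _)]
  exact relLen_anti_right _ fun z hz => key z hz.2 hz.1

variable [IsLocalRing R]

local notation "𝔪" => maximalIdeal R

lemma IsAdmissible.tendsto_lenRatio_inf_satur (h : IsAdmissible I F F') {e : ℕ}
    (hM : HasGrowth R M (e + 1)) (k : ℕ) :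
    Tendsto (lenRatio e F fun n => F n ⊓ satur 𝔪 (F' n) ⊔ 𝔪 ^ k • F n) atTop (𝓝 0) := by
  obtain ⟨s, hs⟩ := h.exists_add_le
  have hT := (h.stable.inf_satur h.filtr 𝔪).toIsFiltr
  have hfin : ∀ n, relLen (F n) (F n ⊓ satur 𝔪 (F' n) ⊔ 𝔪 ^ k • F n) ≠ ⊤ :=
    fun n => relLen_ne_top (IsNoetherian.noetherian _) le_sup_right
  obtain ⟨c, hc⟩ := exists_relLen_add_le h.stable h.filtr 𝔪 k
  have hmul : ∀ n r : ℕ, r * relLen (F n) (F n ⊓ satur 𝔪 (F' n) ⊔ 𝔪 ^ k • F n) ≤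
      relLen (F n) (F n ⊓ satur 𝔪 (F' n) ⊔ 𝔪 ^ (c * r) • F n) := by
    intro n r
    induction r with
    | zero => simp
    | succ r ih =>
      rw [Nat.cast_succ, add_mul, one_mul, add_comm]
      exact (add_le_add_right ih _).trans (hc n (c * r))
  obtain ⟨C, hC⟩ := hM.exists_sum_le h.stable
    (fun n => (hs n).trans (le_inf (h.le n) (le_satur 𝔪 _))) c
  refine EventuallyPoly.tendsto_div_pow_zero (C := C) ?_ fun r hr => ?_
  · exact eventuallyPoly_relLen h.stable.toIsFiltr (hT.sup (h.stable.toIsFiltr.ideal_smul _))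
      (fun n => sup_le inf_le_left Submodule.smul_le_right) (h.stable.relStable _) hfin
  · refine Nat.le_of_mul_le_mul_left ?_ (Nat.pos_of_ne_zero (Nat.one_le_iff_ne_zero.1 hr))
    have h1 : (r : ℕ∞) * ∑ n ∈ Finset.range r,
        ((relLen (F n) (F n ⊓ satur 𝔪 (F' n) ⊔ 𝔪 ^ k • F n)).toNat : ℕ∞) ≤
        C * (r : ℕ∞) ^ (e + 1) := by
      refine le_trans ?_ (hC r hr)
      rw [Finset.mul_sum]
      refine Finset.sum_le_sum fun n _ => ?_
      rw [ENat.natCast_toNat (hfin n)]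
      exact hmul n r
    calc _ ≤ C * r ^ (e + 1) := by exact_mod_cast h1
      _ = _ := by ring

lemma IsAdmissible.exists_tendsto (h : IsAdmissible I F F') {e : ℕ}
    (hM : HasGrowth R M (e + 1)) :
    ∃ a, Tendsto (satRatio 𝔪 e F F') atTop (𝓝 a) ∧ ∃ k₀, ∀ k ≥ k₀,
      Tendsto (lenRatio e F fun n => F' n ⊔ 𝔪 ^ k • F n) atTop (𝓝 a) := by
  obtain ⟨s, hs⟩ := h.exists_add_le
  have hT := h.stable.inf_satur h.filtr 𝔪
  obtain ⟨b, hb⟩ := h.stable.exists_pow_smul_inf_satur_le h.filtr 𝔪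
  obtain ⟨c, hc⟩ := h.stable.exists_inf_pow_smul_le hT.toIsFiltr (fun n => inf_le_left) 𝔪
  have hfin : ∀ n k, relLen (F n) (F' n ⊔ 𝔪 ^ k • F n) ≠ ⊤ :=
    fun n k => relLen_ne_top (IsNoetherian.noetherian _) le_sup_right
  have hsplit : ∀ n, ∀ k ≥ b + c, relLen (F n) (F' n ⊔ 𝔪 ^ k • F n) =
      relLen (F n) (F n ⊓ satur 𝔪 (F' n) ⊔ 𝔪 ^ k • F n) + satLen 𝔪 (F n) (F' n) := by
    intro n k hk
    have h1 : F' n ≤ F n ⊓ satur 𝔪 (F' n) := le_inf (h.le n) (le_satur 𝔪 _)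
    rw [relLen_add (sup_le_sup_right h1 (𝔪 ^ k • F n)) (sup_le inf_le_left Submodule.smul_le_right)]
    congr 1
    refine ((relLen_sup_left_le _ le_sup_right).antisymm (relLen_mono_left le_sup_left _)).trans ?_
    refine relLen_congr fun z hz => ⟨fun hz' => ?_, fun hz' => le_sup_left (a := F' n) hz'⟩
    obtain ⟨v, hv, u, hu, rfl⟩ := Submodule.mem_sup.1 hz'
    refine add_mem hv (hb n (hc n b ⟨?_, Submodule.smul_mono_left (Ideal.pow_le_pow_right hk) hu⟩))
    simpa using sub_mem hz (h1 hv)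
  have hsat : ∀ n, satLen 𝔪 (F n) (F' n) ≠ ⊤ := fun n h0 =>
    hfin n (b + c) (by rw [hsplit n _ le_rfl, h0, add_top])
  obtain ⟨C, hC⟩ := hM.exists_sum_le h.stable hs (b + c)
  obtain ⟨a, ha⟩ : ∃ a, Tendsto (satRatio 𝔪 e F F') atTop (𝓝 a) := by
    refine EventuallyPoly.exists_tendsto_div_pow (C := C) ?_ fun r hr => ?_
    · exact eventuallyPoly_relLen hT.toIsFiltr h.filtr (fun n => le_inf (h.le n) (le_satur 𝔪 _))
        (hT.relStable _) hsat
    · have h1 : ∑ n ∈ Finset.range r, ((satLen 𝔪 (F n) (F' n)).toNat : ℕ∞) ≤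
          C * (r : ℕ∞) ^ (e + 1) := by
        refine le_trans (Finset.sum_le_sum fun n _ => ?_) (hC r hr)
        rw [ENat.natCast_toNat (hsat n), hsplit n _ (Nat.le_mul_of_pos_right _ hr)]
        exact le_add_self
      exact_mod_cast h1
  refine ⟨a, ha, b + c, fun k hk => ?_⟩
  have h1 := (h.tendsto_lenRatio_inf_satur hM k).add ha
  rw [zero_add] at h1
  refine h1.congr fun n => ?_
  rw [lenRatio, lenRatio, satRatio, hsplit n k hk, ENat.toNat_add
    (relLen_ne_top (IsNoetherian.noetherian _) le_sup_right) (hsat n), Nat.cast_add, add_div]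

/-- Additivity of the limits of the length functions of `H⁰_𝔪`. -/
theorem IsAdmissible.limit_add (h : IsAdmissible I F F') (hF'' : IsFiltr I F'')
    (h1 : ∀ n, F' n ≤ F'' n) (h2 : ∀ n, F'' n ≤ F n) {e : ℕ} (hM : HasGrowth R M (e + 1))
    {a b c : ℝ} (ha : Tendsto (satRatio 𝔪 e F F') atTop (𝓝 a))
    (hb : Tendsto (satRatio 𝔪 e F F'') atTop (𝓝 b))
    (hc : Tendsto (satRatio 𝔪 e F'' F') atTop (𝓝 c)) : a = b + c := by
  obtain ⟨hA, hB⟩ := h.of_le_of_le hF'' h1 h2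
  obtain ⟨a', ha', ka, hka⟩ := h.exists_tendsto hM
  obtain ⟨b', hb', kb, hkb⟩ := hA.exists_tendsto hM
  obtain ⟨c', hc', kc, hkc⟩ := hB.exists_tendsto hM
  obtain rfl := tendsto_nhds_unique ha ha'
  obtain rfl := tendsto_nhds_unique hb hb'
  obtain rfl := tendsto_nhds_unique hc hc'
  obtain ⟨l, hl⟩ := h.stable.exists_inf_pow_smul_le hF'' h2 𝔪
  set k := ka + kb + kc
  have hfin : ∀ (G G' : ℕ → Submodule R M) j n, relLen (G n) (G' n ⊔ 𝔪 ^ j • G n) ≠ ⊤ :=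
    fun G G' j n => relLen_ne_top (IsNoetherian.noetherian _) le_sup_right
  have hsplit : ∀ n, relLen (F n) (F' n ⊔ 𝔪 ^ (k + l) • F n) =
      relLen (F n) (F'' n ⊔ 𝔪 ^ (k + l) • F n) + relLen (F'' n) (F' n ⊔ 𝔪 ^ (k + l) • F n) := by
    intro n
    rw [relLen_add (sup_le_sup_right (h1 n) (𝔪 ^ (k + l) • F n))
      (sup_le (h2 n) Submodule.smul_le_right)]
    congr 1
    exact (relLen_sup_left_le _ le_sup_right).antisymm (relLen_mono_left le_sup_left _)
  have hlow : ∀ n, relLen (F'' n) (F' n ⊔ 𝔪 ^ k • F'' n) ≤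
      relLen (F'' n) (F' n ⊔ 𝔪 ^ (k + l) • F n) := by
    intro n
    rw [← relLen_inf_right (F'' n) (F' n ⊔ 𝔪 ^ (k + l) • F n)]
    refine relLen_anti_right _ ?_
    rw [sup_inf_assoc_of_le _ (h1 n), inf_comm]
    exact sup_le_sup_left (hl n k) _
  have hup : ∀ n, relLen (F'' n) (F' n ⊔ 𝔪 ^ (k + l) • F n) ≤
      relLen (F'' n) (F' n ⊔ 𝔪 ^ (k + l) • F'' n) := fun n =>
    relLen_anti_right _ (sup_le_sup_left (smul_mono_right _ (h2 n)) _)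
  apply le_antisymm
  · refine le_of_tendsto_of_tendsto' (hka (k + l) (by lia))
      ((hkb (k + l) (by lia)).add (hkc (k + l) (by lia))) fun n => ?_
    rw [lenRatio, lenRatio, lenRatio, ← add_div, ← Nat.cast_add,
      ← ENat.toNat_add (hfin _ _ _ n) (hfin _ _ _ n)]
    gcongr
    · exact WithTop.add_ne_top.2 ⟨hfin _ _ _ n, hfin _ _ _ n⟩
    · rw [hsplit]
      exact add_le_add_right (hup n) _
  · refine le_of_tendsto_of_tendsto' ((hkb (k + l) (by lia)).add (hkc k (by lia)))
      (hka (k + l) (by lia)) fun n => ?_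
    rw [lenRatio, lenRatio, lenRatio, ← add_div, ← Nat.cast_add,
      ← ENat.toNat_add (hfin _ _ _ n) (hfin _ _ _ n)]
    gcongr
    · exact hfin _ _ _ n
    · rw [hsplit]
      exact add_le_add_right (hlow n) _

end Limits

section Assembly

open IsLocalRing Topology

variable {R M : Type*} [CommRing R] [AddCommGroup M] [Module R M]

lemma satLen_sup_left (J : Ideal R) (P Q : Submodule R M) :
    satLen J (P ⊔ Q) Q = satLen J P Q := by
  rw [satLen, sup_comm, sup_inf_assoc_of_le _ (le_satur J Q), sup_comm, relLen_sup_left, satLen]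

lemma jMult_eq_of_tendsto {𝔞 I : Ideal R} {e : ℕ} {a : ℝ}
    (h : Tendsto (satRatio 𝔞 e (fun n => I ^ n • (⊤ : Submodule R M)) fun n => I ^ (n + 1) • ⊤)
      atTop (𝓝 a)) : jMult 𝔞 I M (e + 1) = e.factorial * a := by
  refine Tendsto.limUnder_eq ((h.const_mul (e.factorial : ℝ)).congr fun n => ?_)
  rw [satRatio, gradedPiece, mLength_H0, Nat.add_sub_cancel]
  ring

lemma tendsto_succ_div_pow {u : ℕ → ℝ} {e : ℕ} {a : ℝ}
    (h : Tendsto (fun n : ℕ => u n / (n : ℝ) ^ e) atTop (𝓝 a)) :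
    Tendsto (fun n : ℕ => u (n + 1) / (n : ℝ) ^ e) atTop (𝓝 a) := by
  have h1 := ((tendsto_add_atTop_iff_nat 1).2 h).mul
    (((tendsto_const_nhds (x := (1 : ℝ))).add (tendsto_one_div_atTop_nhds_zero_nat (𝕜 := ℝ))).pow e)
  rw [add_zero, one_pow, mul_one] at h1
  refine h1.congr' ?_
  filter_upwards [eventually_gt_atTop 0] with n hn
  have : (n : ℝ) ≠ 0 := by positivity
  push_cast
  rw [show 1 + 1 / (n : ℝ) = (n + 1) / n by field_simp, div_pow]
  have : (n : ℝ) + 1 ≠ 0 := by positivity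
  field_simp

variable [IsNoetherianRing R] [Module.Finite R M] [IsLocalRing R]
  {L N : Type*} [AddCommGroup L] [Module R L] [AddCommGroup N] [Module R N]

local notation "𝔪" => maximalIdeal R

theorem jMult_add_of_exact (I : Ideal R) {e : ℕ} (hM : HasGrowth R M (e + 1))
    (f : L →ₗ[R] M) (g : M →ₗ[R] N)
    (hf : Function.Injective f) (hg : Function.Surjective g) (hfg : Function.Exact f g) :
    jMult 𝔪 I M (e + 1) = jMult 𝔪 I L (e + 1) + jMult 𝔪 I N (e + 1) := by
  let P : ℕ → Submodule R M := fun n => I ^ n • ⊤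
  let K : ℕ → Submodule R M := fun n => LinearMap.range f ⊓ P n
  let E : ℕ → Submodule R M := fun n => I ^ n • LinearMap.range f
  have hP : IsStableFiltr I P := .pow_smul ⊤
  have hK : IsStableFiltr I K := hP.of_le ((IsFiltr.const _).inf hP.toIsFiltr) fun n => inf_le_right
  have hE : IsStableFiltr I E := .pow_smul _
  have hEK : ∀ n, E n ≤ K n := fun n => le_inf Submodule.smul_le_right (smul_mono_right _ le_top)
  have hker : LinearMap.ker g = LinearMap.range f := hfg.linearMap_ker_eq
  -- the middle filtration
  have hD : IsFiltr I fun n => P (n + 1) ⊔ K n := (hP.toIsFiltr.shift 1).sup hK.toIsFiltr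
  have hPP : IsAdmissible I P fun n => P (n + 1) :=
    ⟨hP, hP.toIsFiltr.shift 1, hP.succ_le, 1, fun n => le_rfl⟩
  have hKE : IsAdmissible I K fun n => E (n + 1) := by
    obtain ⟨c, hc⟩ := hK.exists_add_le_pow_smul
    refine ⟨hK, hE.toIsFiltr.shift 1, fun n => (hE.succ_le n).trans (hEK n), c + 1, fun n => ?_⟩
    rw [← add_assoc, Nat.add_right_comm]
    exact (hc (n + 1)).trans (smul_mono_right _ inf_le_left)
  have hD1 : ∀ n, P (n + 1) ⊔ K n ≤ P n := fun n => sup_le (hP.succ_le n) inf_le_right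
  obtain ⟨hPD, hDP⟩ := hPP.of_le_of_le hD (fun n => le_sup_left) hD1
  obtain ⟨hKK, hKE1⟩ := hKE.of_le_of_le (hK.toIsFiltr.shift 1) (fun n => hEK (n + 1)) hK.succ_le
  obtain ⟨hKE', hEE⟩ := hKE.of_le_of_le hE.toIsFiltr hE.succ_le hEK
  obtain ⟨jM, hjM, -⟩ := hPP.exists_tendsto hM
  obtain ⟨jN, hjN, -⟩ := hPD.exists_tendsto hM
  obtain ⟨jV, hjV, -⟩ := hKE.exists_tendsto hM
  obtain ⟨jW, hjW, -⟩ := hKK.exists_tendsto hM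
  obtain ⟨jQ, hjQ, -⟩ := hKE'.exists_tendsto hM
  obtain ⟨jL, hjL, -⟩ := hEE.exists_tendsto hM
  have hDW : ∀ n, satLen 𝔪 (P (n + 1) ⊔ K n) (P (n + 1)) = satLen 𝔪 (K n) (K (n + 1)) := by
    intro n
    rw [sup_comm, satLen_sup_left, ← satLen_inf_right]
    congr 1
    change P (n + 1) ⊓ (LinearMap.range f ⊓ P n) = LinearMap.range f ⊓ P (n + 1)
    rw [inf_left_comm, inf_eq_left.2 (hP.succ_le n)]
  have hjW' : Tendsto (satRatio 𝔪 e (fun n => P (n + 1) ⊔ K n) fun n => P (n + 1)) atTop (𝓝 jW) :=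
    hjW.congr fun n => by rw [satRatio, satRatio, hDW]
  have e1 : jM = jN + jW := hPP.limit_add hD (fun n => le_sup_left) hD1 hM hjM hjN hjW'
  have e2 : jV = jW + jQ := hKE.limit_add (hK.toIsFiltr.shift 1) (fun n => hEK (n + 1)) hK.succ_le
    hM hjV hjW (tendsto_succ_div_pow hjQ)
  have e3 : jV = jQ + jL := hKE.limit_add hE.toIsFiltr hE.succ_le hEK hM hjV hjQ hjL
  have hN : ∀ n, satLen 𝔪 (I ^ n • (⊤ : Submodule R N)) (I ^ (n + 1) • ⊤) =
      satLen 𝔪 (P n) (P (n + 1) ⊔ K n) := by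
    intro n
    have hmap : ∀ n, I ^ n • (⊤ : Submodule R N) = (P n).map g := fun n => by
      rw [Submodule.map_smul'', Submodule.map_top, LinearMap.range_eq_top.2 hg]
    rw [hmap, hmap, satLen_map, Submodule.comap_map_eq, hker, ← satLen_inf_right,
      sup_inf_assoc_of_le _ (hP.succ_le n)]
  have hL : ∀ n, satLen 𝔪 (I ^ n • (⊤ : Submodule R L)) (I ^ (n + 1) • ⊤) =
      satLen 𝔪 (E n) (E (n + 1)) := by
    intro n
    have hmap : ∀ n, E n = (I ^ n • (⊤ : Submodule R L)).map f := fun n => by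
      rw [Submodule.map_smul'', Submodule.map_top]
    rw [hmap, hmap, satLen_map, Submodule.comap_map_eq_of_injective hf]
  have hjN' : Tendsto (satRatio 𝔪 e (fun n => I ^ n • (⊤ : Submodule R N))
      fun n => I ^ (n + 1) • ⊤) atTop (𝓝 jN) :=
    hjN.congr fun n => by rw [satRatio, satRatio, hN]
  have hjL' : Tendsto (satRatio 𝔪 e (fun n => I ^ n • (⊤ : Submodule R L))
      fun n => I ^ (n + 1) • ⊤) atTop (𝓝 jL) :=
    hjL.congr fun n => by rw [satRatio, satRatio, hL]
  rw [jMult_eq_of_tendsto hjM, jMult_eq_of_tendsto hjN', jMult_eq_of_tendsto hjL', e1]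
  have : jW = jL := by linarith
  rw [this]
  ring

end Assembly

section Dimension

open IsLocalRing

variable {R M : Type*} [CommRing R] [AddCommGroup M] [Module R M]

lemma relLen_map_lsmul_pow_sup_le (x : R) (Q : Submodule R M) (n : ℕ) :
    relLen ⊤ ((⊤ : Submodule R M).map (LinearMap.lsmul R M (x ^ n)) ⊔ Q) ≤
      n * relLen ⊤ ((⊤ : Submodule R M).map (LinearMap.lsmul R M x) ⊔ Q) := by
  induction n with
  | zero =>
    simp only [pow_zero, Nat.cast_zero, zero_mul, nonpos_iff_eq_zero]
    exact relLen_eq_zero fun z _ => Submodule.mem_sup_left ⟨z, trivial, by simp⟩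
  | succ n ih =>
    refine (relLen_le_add _ ((⊤ : Submodule R M).map (LinearMap.lsmul R M x) ⊔ Q) _).trans ?_
    rw [Nat.cast_succ, add_mul, one_mul, add_comm]
    refine add_le_add ((relLen_sup_left_le _ le_sup_right).trans ?_) le_rfl
    rw [relLen_map]
    refine (relLen_anti_right _ ?_).trans ih
    rintro z hz
    obtain ⟨_, ⟨w, -, rfl⟩, q, hq, rfl⟩ := Submodule.mem_sup.1 hz
    refine Submodule.mem_comap.2 ?_
    rw [map_add]
    refine add_mem (Submodule.mem_sup_left ⟨w, trivial, ?_⟩)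
      (Submodule.mem_sup_right (Q.smul_mem x hq))
    simp [smul_smul, pow_succ]

lemma relLen_pow_smul_sup_le (J : Ideal R) (s : Finset R) (hs : (s : Set R) ⊆ J) (n : ℕ)
    (Q : Submodule R M) :
    relLen ⊤ (J ^ n • ⊤ ⊔ Q) ≤ (n : ℕ∞) ^ s.card * relLen ⊤ (Ideal.span (s : Set R) • ⊤ ⊔ Q) := by
  classical
  induction s using Finset.induction_on generalizing Q with
  | empty => simpa using relLen_anti_right ⊤ le_sup_right
  | insert x s hx ih =>
    rw [Finset.coe_insert, Set.insert_subset_iff] at hs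
    have h1 := relLen_map_lsmul_pow_sup_le x (J ^ n • ⊤ ⊔ Q) n
    have h2 : (⊤ : Submodule R M).map (LinearMap.lsmul R M (x ^ n)) ≤ J ^ n • ⊤ ⊔ Q := by
      rintro _ ⟨z, -, rfl⟩
      exact Submodule.mem_sup_left
        (Submodule.smul_mem_smul (Ideal.pow_mem_pow hs.1 n) trivial)
    have h3 : (⊤ : Submodule R M).map (LinearMap.lsmul R M x) ⊔ (Ideal.span (s : Set R) • ⊤) ≤
        Ideal.span (insert x s : Set R) • ⊤ := by
      refine sup_le ?_ (Submodule.smul_mono_left (Ideal.span_mono (Set.subset_insert _ _)))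
      rintro _ ⟨z, -, rfl⟩
      exact Submodule.smul_mem_smul (Ideal.subset_span (Set.mem_insert _ _)) trivial
    have h4 : Ideal.span (insert x s : Set R) • (⊤ : Submodule R M) ≤
        (⊤ : Submodule R M).map (LinearMap.lsmul R M x) ⊔ (Ideal.span (s : Set R) • ⊤) := by
      rw [Ideal.span_insert, Submodule.sup_smul]
      refine sup_le_sup_right (Submodule.smul_le.2 fun r hr z _ => ?_) _
      obtain ⟨c, rfl⟩ := Ideal.mem_span_singleton'.1 hr
      exact ⟨c • z, trivial, by simp [smul_smul, mul_comm]⟩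
    rw [sup_eq_right.2 h2, sup_left_comm] at h1
    rw [Finset.coe_insert, Finset.card_insert_of_notMem hx, pow_succ', mul_assoc,
      ← h3.antisymm h4]
    refine h1.trans (mul_le_mul_right ((ih hs.2 _).trans_eq ?_) _)
    rw [← sup_assoc, sup_comm (_ • _) (Submodule.map _ _)]

/-- A Noetherian local ring has a system of parameters. -/
lemma IsLocalRing.exists_finset_maximalIdeal_pow_le [IsNoetherianRing R] [IsLocalRing R] {d : ℕ}
    (h : ringKrullDim R ≤ d) :
    ∃ s : Finset R, s.card ≤ d ∧ (s : Set R) ⊆ maximalIdeal R ∧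
      ∃ k, maximalIdeal R ^ k ≤ Ideal.span (s : Set R) := by
  obtain ⟨s, hs, hcard⟩ :=
    Ideal.exists_finset_card_eq_height_of_isNoetherianRing (maximalIdeal R)
  refine ⟨s, ?_, Ideal.subset_span.trans hs.1.2, ?_⟩
  · rw [← maximalIdeal_height_eq_ringKrullDim, ← hcard] at h
    exact_mod_cast h
  · refine Ideal.exists_pow_le_of_le_radical_of_fg ?_ (IsNoetherian.noetherian _)
    rw [Ideal.radical_eq_sInf]
    exact le_sInf fun P hP => hs.2 ⟨hP.2, hP.1⟩ (le_maximalIdeal hP.2.ne_top)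

lemma hasGrowth_of_mDim_le [IsNoetherianRing R] [IsLocalRing R] [Module.Finite R M] {d : ℕ}
    (h : mDim R M ≤ d) : HasGrowth R M d := by
  classical
  by_cases htop : Module.annihilator R M = ⊤
  · have : Subsingleton M := Module.annihilator_eq_top_iff.1 htop
    exact ⟨0, fun N _ => (relLen_eq_zero fun z _ => by simp [Subsingleton.elim z 0]).le.trans
      zero_le⟩
  have : Nontrivial (R ⧸ Module.annihilator R M) := Ideal.Quotient.nontrivial_iff.2 htop
  set π := Ideal.Quotient.mk (Module.annihilator R M)
  have hπ : Function.Surjective π := Ideal.Quotient.mk_surjective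
  have : IsLocalRing (R ⧸ Module.annihilator R M) := .of_surjective' π hπ
  obtain ⟨s, hcard, hs, k, hk⟩ := exists_finset_maximalIdeal_pow_le h
  have := IsLocalHom.of_surjective π hπ
  have hcomap := maximalIdeal_comap π
  set o : Finset R := s.image (Function.surjInv hπ)
  have ho : o.image π = s := by
    simp [o, Finset.image_image, Function.comp_def, Function.surjInv_eq]
  have hom : (o : Set R) ⊆ maximalIdeal R := by
    intro x hx
    rw [← hcomap]
    exact hs (by rw [← ho]; exact_mod_cast Finset.mem_image_of_mem π hx)
  have hpow : maximalIdeal R ^ k • (⊤ : Submodule R M) ≤ Ideal.span (o : Set R) • ⊤ ⊔ ⊥ := by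
    have h1 : maximalIdeal R ^ k ≤ Ideal.span (o : Set R) ⊔ Module.annihilator R M := by
      rw [← map_maximalIdeal_of_surjective π hπ, ← ho, Finset.coe_image, ← Ideal.map_span,
        ← Ideal.map_pow, Ideal.map_le_iff_le_comap, Ideal.comap_map_of_surjective' π hπ,
        Ideal.mk_ker] at hk
      exact hk
    refine (Submodule.smul_mono_left h1).trans ?_
    rw [Submodule.sup_smul]
    refine sup_le_sup_left (Submodule.smul_le.2 fun r hr z _ => ?_) _
    simp [Module.mem_annihilator.1 hr z]
  have hfin := relLen_ne_top (Module.Finite.fg_top) hpow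
  refine ⟨(relLen ⊤ (Ideal.span (o : Set R) • (⊤ : Submodule R M) ⊔ ⊥)).toNat, fun N hN => ?_⟩
  have h1 := relLen_pow_smul_sup_le (maximalIdeal R) o hom N (⊥ : Submodule R M)
  rw [sup_bot_eq (maximalIdeal R ^ N • _)] at h1
  rw [ENat.natCast_toNat hfin, mul_comm]
  refine h1.trans (mul_le_mul_left ?_ _)
  exact pow_le_pow_right₀ (by exact_mod_cast hN) (Finset.card_image_le.trans hcard)

end Dimension

/-- Theorem 3.8 (additivity): if `0 → L → M → N → 0` is exact and `dim M ≤ d`, then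
`j_d(I, M) = j_d(I, L) + j_d(I, N)`. -/
theorem stmt_15 {R : Type*} [CommRing R] [IsNoetherianRing R] [IsLocalRing R]
    (hdim : 0 < ringKrullDim R) (hres : Infinite (IsLocalRing.ResidueField R))
    (I : Ideal R) (hI : I ≠ ⊤) (d : ℕ) (hd : 0 < d)
    (L M N : Type*) [AddCommGroup L] [Module R L] [Module.Finite R L]
    [AddCommGroup M] [Module R M] [Module.Finite R M]
    [AddCommGroup N] [Module R N] [Module.Finite R N]
    (f : L →ₗ[R] M) (g : M →ₗ[R] N)
    (hf : Function.Injective f) (hg : Function.Surjective g)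
    (hfg : Function.Exact f g)
    (hMd : mDim R M ≤ (d : WithBot ℕ∞)) :
    jMult (IsLocalRing.maximalIdeal R) I M d =
      jMult (IsLocalRing.maximalIdeal R) I L d +
        jMult (IsLocalRing.maximalIdeal R) I N d := by
  obtain ⟨e, rfl⟩ : ∃ e, d = e + 1 := ⟨d - 1, by lia⟩
  exact jMult_add_of_exact I (hasGrowth_of_mDim_le hMd) f g hf hg hfg

end
end

section
/- Let (S, 𝔫) be a 1-dimensional Cohen–Macaulay Noetherian local ring and let T be an extension ring of S such that T/S has finite length as an S-module. Let 𝔞 be an 𝔫-primary ideal of S and let v ∈ T be a non-zero-divisor of T such that 𝔞v ⊆ S. Then 𝔞v is an 𝔫-primary ideal of S and length_S(S/𝔞v) ≥ length_S(S/𝔞); moreover equality holds if v is a unit of T. -/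
open Filter

noncomputable section

/-- A Noetherian local ring is Cohen–Macaulay iff its maximal ideal contains a regular
sequence whose length is the Krull dimension. -/
def IsCMLocalRing (A : Type*) [CommRing A] [IsLocalRing A] : Prop :=
  ∃ rs : List A, (∀ x ∈ rs, x ∈ IsLocalRing.maximalIdeal A) ∧
    RingTheory.Sequence.IsRegular A rs ∧ ((rs.length : ℕ∞) : WithBot ℕ∞) = ringKrullDim A

theorem mLength_eq_length (R M : Type*) [CommRing R] [AddCommGroup M] [Module R M] :
    mLength R M = Module.length R M :=
  (Module.length_eq_height R M).symm

theorem length_quotient_eq_comap_add_range {R M N : Type*} [CommRing R]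
    [AddCommGroup M] [Module R M] [AddCommGroup N] [Module R N] (f : M →ₗ[R] N)
    (P : Submodule R N) (hP : P ≤ LinearMap.range f) :
    Module.length R (N ⧸ P) =
      Module.length R (M ⧸ P.comap f) + Module.length R (N ⧸ LinearMap.range f) := by
  refine Module.length_eq_add_of_exact ((P.comap f).mapQ P f le_rfl) (Submodule.factor hP)
    ?_ (Submodule.factor_surjective hP) ?_
  · rw [← LinearMap.ker_eq_bot, Submodule.ker_mapQ, Submodule.mkQ_map_self]
  · intro x
    obtain ⟨n, rfl⟩ := P.mkQ_surjective x
    rw [Submodule.factor_mk, Submodule.mkQ_apply, Submodule.mkQ_apply,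
      Submodule.Quotient.mk_eq_zero]
    constructor
    · rintro ⟨m, rfl⟩
      exact ⟨Submodule.Quotient.mk m, rfl⟩
    · rintro ⟨y, hy⟩
      obtain ⟨m, rfl⟩ := Submodule.mkQ_surjective _ y
      have h : f m - n ∈ P := (Submodule.Quotient.eq P).1 hy
      have := Submodule.sub_mem _ (LinearMap.mem_range_self f m) (hP h)
      simpa using this

theorem exists_maximalIdeal_pow_smul_top_eq_bot {R M : Type*} [CommRing R] [IsLocalRing R]
    [AddCommGroup M] [Module R M] [IsNoetherianRing R] (h : IsFiniteLength R M) :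
    ∃ n : ℕ, (IsLocalRing.maximalIdeal R ^ n • ⊤ : Submodule R M) = ⊥ := by
  obtain ⟨_, _⟩ := isFiniteLength_iff_isNoetherian_isArtinian.1 h
  obtain ⟨n, hn⟩ := IsArtinian.monotone_stabilizes
    (R := R) (M := M) ⟨fun n => OrderDual.toDual (IsLocalRing.maximalIdeal R ^ n • ⊤),
      fun _ _ h => Submodule.smul_mono_left (Ideal.pow_le_pow_right h)⟩
  have hn' : (IsLocalRing.maximalIdeal R ^ n • ⊤ : Submodule R M) =
    IsLocalRing.maximalIdeal R ^ (n + 1) • ⊤ := hn (n + 1) n.le_succ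
  refine ⟨n, Submodule.eq_bot_of_le_smul_of_le_jacobson_bot (IsLocalRing.maximalIdeal R) _
    (IsNoetherian.noetherian _) ?_ (IsLocalRing.maximalIdeal_le_jacobson _)⟩
  rw [← Submodule.mul_smul, ← pow_succ', ← hn']

theorem ringKrullDim_le_of_isIntegral (R A : Type*) [CommRing R] [CommRing A] [Algebra R A]
    [Algebra.IsIntegral R A] : ringKrullDim A ≤ ringKrullDim R :=
  Order.krullDim_le_of_strictMono (PrimeSpectrum.comap (algebraMap R A)) fun _ _ h =>
    Ideal.IsIntegral.comap_lt_comap h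

theorem exists_maximalIdeal_pow_map_eq_bot (R A : Type*) [CommRing R] [IsLocalRing R]
    [CommRing A] [Algebra R A] [Algebra.IsIntegral R A] [IsArtinianRing A] :
    ∃ n : ℕ, (IsLocalRing.maximalIdeal R ^ n).map (algebraMap R A) = ⊥ := by
  obtain ⟨n, hn⟩ := IsArtinianRing.isNilpotent_jacobson_bot (R := A)
  refine ⟨n, ?_⟩
  rw [Ideal.map_pow, eq_bot_iff]
  refine (Ideal.pow_right_mono ?_ n).trans hn.le
  refine le_sInf fun Q hQ => ?_
  have : Q.IsMaximal := hQ.2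
  rw [Ideal.map_le_iff_le_comap]
  exact (IsLocalRing.eq_maximalIdeal
    (Ideal.isMaximal_comap_of_isIntegral_of_isMaximal (R := R) Q)).ge

theorem exists_maximalIdeal_pow_le_comap_span_singleton {R A : Type*} [CommRing R]
    [IsNoetherianRing R] [IsLocalRing R] [CommRing A] [Algebra R A] [Module.Finite R A]
    (hdim : ringKrullDim R ≤ 1) {v : A} (hv : v ∈ nonZeroDivisors A) :
    ∃ n : ℕ, IsLocalRing.maximalIdeal R ^ n ≤ (Ideal.span {v}).comap (algebraMap R A) := by
  have : IsNoetherianRing A := IsNoetherianRing.of_finite R A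
  have hle : ringKrullDim (A ⧸ Ideal.span {v}) + 1 ≤ 0 + 1 :=
    (ringKrullDim_quotient_succ_le_of_nonZeroDivisor hv).trans
      ((ringKrullDim_le_of_isIntegral R A).trans (by simpa using hdim))
  have : Ring.KrullDimLE 0 (A ⧸ Ideal.span {v}) :=
    (Order.krullDimLE_iff _ _).2 (ENat.WithBot.add_le_add_one_right_iff.1 hle)
  have : IsArtinianRing (A ⧸ Ideal.span {v}) := isArtinianRing_iff_krullDimLE_zero.2 this
  obtain ⟨n, hn⟩ := exists_maximalIdeal_pow_map_eq_bot R (A ⧸ Ideal.span {v})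
  refine ⟨n, fun x hx => ?_⟩
  have hzero : Ideal.Quotient.mk (Ideal.span {v}) (algebraMap R A x) = 0 :=
    hn.le (Ideal.mem_map_of_mem _ hx)
  exact Ideal.mem_comap.2 (Ideal.Quotient.eq_zero_iff_mem.1 hzero)

/-- Lemma 4.6: let `(S, 𝔫)` be a 1-dimensional Cohen–Macaulay Noetherian local ring, `T` an
extension ring of `S` with `length_S (T/S) < ∞`, `𝔞` an `𝔫`-primary ideal and `v ∈ T` a
non-zero-divisor with `𝔞v ⊆ S`. Then `𝔞v` is `𝔫`-primary, `length_S (S/𝔞v) ≥ length_S (S/𝔞)`,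
with equality if `v` is a unit of `T`. -/
theorem stmt_18 {S : Type*} [CommRing S] [IsNoetherianRing S] [IsLocalRing S]
    (hdim : ringKrullDim S = (1 : WithBot ℕ∞)) (hCM : IsCMLocalRing S)
    (T : Type*) [CommRing T] [Algebra S T]
    (hinj : Function.Injective (algebraMap S T))
    (hTS : mLength S (T ⧸ LinearMap.range (Algebra.linearMap S T)) ≠ ⊤)
    (𝔞 : Ideal S) (h𝔞 : 𝔞 ≠ ⊤)
    (h𝔞prim : ∃ n : ℕ, IsLocalRing.maximalIdeal S ^ n ≤ 𝔞)
    (v : T) (hv : v ∈ nonZeroDivisors T)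
    (hav : Submodule.map (LinearMap.mul S T v)
        (Submodule.map (Algebra.linearMap S T) (𝔞 : Submodule S S)) ≤
      LinearMap.range (Algebra.linearMap S T)) :
    (Submodule.comap (Algebra.linearMap S T)
        (Submodule.map (LinearMap.mul S T v)
          (Submodule.map (Algebra.linearMap S T) (𝔞 : Submodule S S))) ≠ ⊤ ∧
      ∃ n : ℕ, (IsLocalRing.maximalIdeal S ^ n : Ideal S) ≤
        Submodule.comap (Algebra.linearMap S T)
          (Submodule.map (LinearMap.mul S T v)
            (Submodule.map (Algebra.linearMap S T) (𝔞 : Submodule S S)))) ∧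
    mLength S (S ⧸ 𝔞) ≤
      mLength S (S ⧸ (Submodule.comap (Algebra.linearMap S T)
        (Submodule.map (LinearMap.mul S T v)
          (Submodule.map (Algebra.linearMap S T) (𝔞 : Submodule S S))) : Ideal S)) ∧
    (IsUnit v →
      mLength S (S ⧸ (Submodule.comap (Algebra.linearMap S T)
        (Submodule.map (LinearMap.mul S T v)
          (Submodule.map (Algebra.linearMap S T) (𝔞 : Submodule S S))) : Ideal S)) =
        mLength S (S ⧸ 𝔞)) := by
  set f := Algebra.linearMap S T with hf
  set A := Submodule.map f 𝔞 with hA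
  set B := Submodule.map (LinearMap.mul S T v) A with hB
  rw [mLength_eq_length] at hTS
  simp only [mLength_eq_length]
  have hmul : Function.Injective (LinearMap.mul S T v) := fun x y h =>
    (isRegular_iff_mem_nonZeroDivisors.2 hv).left h
  have hlenB := length_quotient_eq_comap_add_range f B hav
  have hlenA := length_quotient_eq_comap_add_range f A LinearMap.map_le_range
  have hlenv := length_quotient_eq_comap_add_range (LinearMap.mul S T v) B LinearMap.map_le_range
  rw [Submodule.comap_map_eq_of_injective hinj] at hlenA
  rw [Submodule.comap_map_eq_of_injective hmul] at hlenv
  have hle : Module.length S (S ⧸ 𝔞) ≤ Module.length S (S ⧸ B.comap f) := by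
    rw [← ENat.add_le_add_iff_right hTS, ← hlenA, ← hlenB, hlenv]
    exact le_self_add
  refine ⟨⟨fun h => h𝔞 ?_, ?_⟩, hle, fun hu => ?_⟩
  · have : Subsingleton (S ⧸ B.comap f) := Submodule.Quotient.subsingleton_iff.2 h
    rw [Module.length_eq_zero (M := S ⧸ B.comap f), nonpos_iff_eq_zero,
      Module.length_eq_zero_iff] at hle
    exact Submodule.Quotient.subsingleton_iff.1 hle
  · have hfin := Module.length_ne_top_iff.1 hTS
    obtain ⟨_, -⟩ := isFiniteLength_iff_isNoetherian_isArtinian.1 hfin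
    have : Module.Finite S T := .of_submodule_quotient (LinearMap.range f)
    obtain ⟨m, hm⟩ := h𝔞prim
    obtain ⟨n, hn⟩ := exists_maximalIdeal_pow_le_comap_span_singleton hdim.le hv
    obtain ⟨k, hk⟩ := exists_maximalIdeal_pow_smul_top_eq_bot hfin
    refine ⟨n + k + m, ?_⟩
    rw [pow_add, pow_add, Ideal.mul_le]
    intro r hr z hz
    suffices h : IsLocalRing.maximalIdeal S ^ n * IsLocalRing.maximalIdeal S ^ k ≤
        (B.comap f).comap (LinearMap.mulRight S z) from h hr
    rw [Ideal.mul_le]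
    intro x hx y hy
    obtain ⟨t, ht⟩ := Ideal.mem_span_singleton'.1 (hn hx)
    have hyt : y • t ∈ LinearMap.range f := by
      rw [← Submodule.Quotient.mk_eq_zero, Submodule.Quotient.mk_smul]
      exact (Submodule.eq_bot_iff _).1 hk _ (Submodule.smul_mem_smul hy trivial)
    obtain ⟨s, hs⟩ := hyt
    refine ⟨f (s * z), ⟨s * z, 𝔞.mul_mem_left s (hm hz), rfl⟩, ?_⟩
    simp only [hf, Algebra.linearMap_apply, Algebra.smul_def, LinearMap.mul_apply',
      LinearMap.mulRight_apply, map_mul] at hs ⊢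
    rw [hs, ← ht]
    ring
  · have hrange : LinearMap.range (LinearMap.mul S T v) = ⊤ :=
      LinearMap.range_eq_top.2 fun t => by
        obtain ⟨w, hw⟩ := hu.exists_right_inv
        exact ⟨w * t, by rw [LinearMap.mul_apply', ← mul_assoc, hw, one_mul]⟩
    have : Subsingleton (T ⧸ LinearMap.range (LinearMap.mul S T v)) :=
      Submodule.Quotient.subsingleton_iff.2 hrange
    rw [Module.length_eq_zero (M := T ⧸ LinearMap.range (LinearMap.mul S T v)), add_zero] at hlenv
    exact ENat.add_left_injective_of_ne_top hTS (hlenB.symm.trans (hlenv.trans hlenA))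

end
end
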